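/- The multiplex M^{d,n} has the same flag vector as the (d-2)-fold pyramid over the (n-d+3)-gon; in particular, for every S ⊆ {0,1,...,d-1}, f_S(M^{d,n}) = f_S(Q^{d,n-d}), where Q^{d,m} denotes the (d-2)-fold pyramid over the (m+3)-gon. -/

import Mathlib

open Set

variable {E : Type*} [NormedAddCommGroup E] [NormedSpace ℝ E]

/-- The dimension of a (nonempty convex) set: the dimension of its affine span. -/
noncomputable def pdim (F : Set E) : ℕ := Module.finrank ℝ (affineSpan ℝ F).direction

/-- `F` is a (nonempty) face of the polytope `P`. -/
def IsFaceOf (P F : Set E) : Prop := IsExposed ℝ P F ∧ F.Nonempty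

/-- The number of `i`-dimensional faces of `P`. -/
noncomputable def faceCount (P : Set E) (i : ℕ) : ℕ :=
  {F : Set E | IsFaceOf P F ∧ pdim F = i}.ncard

/-- The flag number `f_S(P)`: the number of chains of faces of `P` whose set of
dimensions is `S`.  A chain is recorded as a function `c : ℕ → Set E` that assigns
to each `s ∈ S` a face of dimension `s`, increasingly with `s`, and `∅` off `S`. -/
noncomputable def flagNum (P : Set E) (S : Finset ℕ) : ℕ :=
  {c : ℕ → Set E | (∀ s ∈ S, IsFaceOf P (c s) ∧ pdim (c s) = s) ∧
    (∀ s ∈ S, ∀ t ∈ S, s ≤ t → c s ⊆ c t) ∧ ∀ s, s ∉ S → c s = ∅}.ncard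

/-- `P` is the multiplex `M^{d,n}` with ordered vertices `x 0, …, x n`, where the
vertex list is extended to all integer indices by the conventions `x j = x 0` for
`j < 0` and `x j = x n` for `j > n`.  Its facets are exactly the sets
`F i = conv{x (i-d+1), …, x (i-1), x (i+1), …, x (i+d-1)}` for `0 ≤ i ≤ n`. -/
structure IsMultiplex (d n : ℕ) (P : Set E) (x : ℤ → E) : Prop where
  two_le_d : 2 ≤ d
  d_le_n : d ≤ n
  clamp_lo : ∀ j : ℤ, j ≤ 0 → x j = x 0
  clamp_hi : ∀ j : ℤ, (n : ℤ) ≤ j → x j = x n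
  inj : Set.InjOn x (Icc (0:ℤ) (n:ℤ))
  hull : P = convexHull ℝ (x '' Icc (0:ℤ) (n:ℤ))
  verts : Set.extremePoints ℝ P = x '' Icc (0:ℤ) (n:ℤ)
  dim : pdim P = d
  facets : ∀ F : Set E, (IsFaceOf P F ∧ pdim F = d - 1) ↔
      ∃ i ∈ Icc (0:ℤ) (n:ℤ),
        F = convexHull ℝ (x '' (Icc (i - d + 1) (i + d - 1) \ {i}))

/-- `Q` is a `k`-fold pyramid over the base `B`: `Q` is obtained from `B` by
iterating the pyramid construction (taking the convex hull with a new apex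
outside the affine span) `k` times. -/
def IsKFoldPyramid : ℕ → Set E → Set E → Prop
  | 0, Q, B => Q = B
  | (k + 1), Q, B => ∃ (R : Set E) (a : E), IsKFoldPyramid k R B ∧
      a ∉ affineSpan ℝ R ∧ Q = convexHull ℝ (insert a R)

/-- `B` is an `m`-gon: a two-dimensional polytope with exactly `m` vertices. -/
def IsPolygon (m : ℕ) (B : Set E) : Prop :=
  ∃ v : Finset E, v.card = m ∧ B = convexHull ℝ (v : Set E) ∧
    Set.extremePoints ℝ B = (v : Set E) ∧ pdim B = 2


/-- Number of ranked chains indexed by `S`. -/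
noncomputable def cnt {α : Type*} (p : α → ℕ → Prop) (le : α → α → Prop) (S : Finset ℕ) : ℕ :=
  Nat.card {c : S → α // (∀ s : S, p (c s) s.1) ∧ ∀ s t : S, s.1 ≤ t.1 → le (c s) (c t)}

/-- Number of ranked chains with some member satisfying `P`. -/
noncomputable def cntEx {α : Type*} (p : α → ℕ → Prop) (le : α → α → Prop) (P : α → Prop)
    (S : Finset ℕ) : ℕ :=
  Nat.card {c : S → α // ((∀ s : S, p (c s) s.1) ∧ ∀ s t : S, s.1 ≤ t.1 → le (c s) (c t)) ∧
    ∃ s, P (c s)}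

theorem cnt_congr {α β : Type*} {p : α → ℕ → Prop} {q : β → ℕ → Prop} {le : α → α → Prop}
    {le' : β → β → Prop} {S : Finset ℕ} (f : α → β)
    (hp : ∀ x, ∀ s ∈ S, p x s → q (f x) s)
    (hs : ∀ y, ∀ s ∈ S, q y s → ∃ x, p x s ∧ f x = y)
    (hi : ∀ x y, ∀ s ∈ S, p x s → p y s → f x = f y → x = y)
    (hle : ∀ x y, ∀ s ∈ S, ∀ t ∈ S, s ≤ t → p x s → p y t → (le x y ↔ le' (f x) (f y))) :
    cnt p le S = cnt q le' S := by
  unfold cnt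
  refine Nat.card_congr (Equiv.ofBijective
    (fun c => ⟨fun s => f (c.1 s), fun s => hp _ _ s.2 (c.2.1 s), fun s t h =>
      (hle _ _ _ s.2 _ t.2 h (c.2.1 s) (c.2.1 t)).1 (c.2.2 s t h)⟩) ⟨?_, ?_⟩)
  · intro c c' h
    apply Subtype.ext
    funext s
    have := congrFun (congrArg Subtype.val h) s
    exact hi _ _ _ s.2 (c.2.1 s) (c'.2.1 s) this
  · intro c
    have h : ∀ s : S, ∃ x, p x s.1 ∧ f x = c.1 s := fun s => hs _ _ s.2 (c.2.1 s)
    choose g hg using h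
    refine ⟨⟨g, fun s => (hg s).1, fun s t hst => ?_⟩, ?_⟩
    · rw [hle _ _ _ s.2 _ t.2 hst (hg s).1 (hg t).1, (hg s).2, (hg t).2]
      exact c.2.2 s t hst
    · apply Subtype.ext
      funext s
      exact (hg s).2

theorem chain_finite {α : Type*} {p : α → ℕ → Prop} (le : α → α → Prop) {S : Finset ℕ}
    (hf : ∀ s ∈ S, {x | p x s}.Finite) :
    Finite {c : S → α // (∀ s : S, p (c s) s.1) ∧ ∀ s t : S, s.1 ≤ t.1 → le (c s) (c t)} := by
  have : ∀ s : S, Finite {x // p x s.1} := fun s => (hf s.1 s.2)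
  refine Finite.of_injective
    (fun c => (fun s => ⟨c.1 s, c.2.1 s⟩ : ∀ s : S, {x // p x s.1})) ?_
  intro c c' h
  apply Subtype.ext
  funext s
  have := congrFun h s
  exact congrArg Subtype.val this

theorem cnt_split {α : Type*} {p : α → ℕ → Prop} {le : α → α → Prop} {S : Finset ℕ}
    (P : α → Prop) (hf : ∀ s ∈ S, {x | p x s}.Finite) :
    cnt p le S = cntEx p le P S + cnt (fun x s => p x s ∧ ¬ P x) le S := by
  classical
  unfold cnt cntEx
  have := chain_finite le hf
  have h1 := Nat.card_congr (Equiv.sumCompl (fun c : {c : S → α // (∀ s : S, p (c s) s.1) ∧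
    ∀ s t : S, s.1 ≤ t.1 → le (c s) (c t)} => ∃ s, P (c.1 s)))
  rw [Nat.card_sum] at h1
  rw [← h1]
  congr 1
  · exact Nat.card_congr (Equiv.subtypeSubtypeEquivSubtypeInter (fun c : S → α =>
      (∀ s : S, p (c s) s.1) ∧ ∀ s t : S, s.1 ≤ t.1 → le (c s) (c t)) (fun c => ∃ s, P (c s)))
  · refine Nat.card_congr ((Equiv.subtypeSubtypeEquivSubtypeInter (fun c : S → α =>
      (∀ s : S, p (c s) s.1) ∧ ∀ s t : S, s.1 ≤ t.1 → le (c s) (c t))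
      (fun c => ¬ ∃ s, P (c s))).trans (Equiv.subtypeEquivRight ?_))
    intro c
    constructor
    · rintro ⟨⟨h1, h2⟩, h3⟩
      exact ⟨fun s => ⟨h1 s, fun h => h3 ⟨s, h⟩⟩, h2⟩
    · rintro ⟨h1, h2⟩
      exact ⟨⟨fun s => (h1 s).1, h2⟩, fun ⟨s, h⟩ => (h1 s).2 h⟩

theorem cntEx_congr {α : Type*} {p q : α → ℕ → Prop} {le : α → α → Prop} {P : α → Prop}
    {S : Finset ℕ}
    (h : ∀ c : S → α, (∀ s t : S, s.1 ≤ t.1 → le (c s) (c t)) → (∃ s, P (c s)) →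
      ((∀ s : S, p (c s) s.1) ↔ ∀ s : S, q (c s) s.1)) :
    cntEx p le P S = cntEx q le P S := by
  unfold cntEx
  refine Nat.card_congr (Equiv.subtypeEquivRight ?_)
  intro c
  constructor
  · rintro ⟨⟨h1, h2⟩, h3⟩
    exact ⟨⟨(h c h2 h3).1 h1, h2⟩, h3⟩
  · rintro ⟨⟨h1, h2⟩, h3⟩
    exact ⟨⟨(h c h2 h3).2 h1, h2⟩, h3⟩

theorem flagNum_eq_cnt {E : Type*} [NormedAddCommGroup E] [NormedSpace ℝ E]
    (P : Set E) (S : Finset ℕ) :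
    flagNum P S = cnt (fun F s => IsFaceOf P F ∧ pdim F = s) (· ⊆ ·) S := by
  classical
  unfold flagNum cnt
  rw [← Nat.card_coe_set_eq]
  refine Nat.card_congr (Equiv.ofBijective
    (fun c => ⟨fun s => c.1 s.1, fun s => c.2.1 s.1 s.2, fun s t h =>
      c.2.2.1 s.1 s.2 t.1 t.2 h⟩) ⟨?_, ?_⟩)
  · intro c c' h
    apply Subtype.ext
    funext s
    by_cases hs : s ∈ S
    · exact congrFun (congrArg Subtype.val h) ⟨s, hs⟩
    · rw [c.2.2.2 s hs, c'.2.2.2 s hs]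
  · intro c
    refine ⟨⟨fun s => if hs : s ∈ S then c.1 ⟨s, hs⟩ else ∅, ?_, ?_, ?_⟩, ?_⟩
    · intro s hs
      simp only [hs, dite_true]
      exact c.2.1 ⟨s, hs⟩
    · intro s hs t ht hst
      simp only [hs, ht, dite_true]
      exact c.2.2 ⟨s, hs⟩ ⟨t, ht⟩ hst
    · intro s hs
      simp [hs]
    · apply Subtype.ext
      funext s
      simp

/-- Faces of a polygon-like incidence structure. -/
inductive PF (β γ : Type*) where
  | bot : PF β γ
  | vert : β → PF β γ
  | edge : γ → PF β γ
  | top : PF β γ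

namespace PF
variable {β γ : Type*}

def rk : PF β γ → ℕ
  | bot => 0
  | vert _ => 1
  | edge _ => 2
  | top => 3

def le (inc : β → γ → Prop) : PF β γ → PF β γ → Prop
  | bot, _ => True
  | _, top => True
  | vert a, vert b => a = b
  | vert a, edge b => inc a b
  | edge a, edge b => a = b
  | _, _ => False

theorem le_rk {inc : β → γ → Prop} {x y : PF β γ} (h : le inc x y) : x.rk ≤ y.rk := by
  cases x <;> cases y <;> simp_all [le, rk]

end PF

def plp {β γ : Type*} (M : Finset ℤ) (x : Finset ℤ × PF β γ) (s : ℕ) : Prop :=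
  x.1 ⊆ M ∧ x.1.card + x.2.rk = s + 1

def plle {β γ : Type*} (inc : β → γ → Prop) (x y : Finset ℤ × PF β γ) : Prop :=
  x.1 ⊆ y.1 ∧ PF.le inc x.2 y.2

/-- Patterns of chains hitting exactly the values in `A` among `1, 2`. -/
def PatHit (S : Finset ℕ) (A : Finset ℕ) (c : S → ℕ) : Prop :=
  (∀ s, c s ∈ A) ∧ ∀ a ∈ A, a = 1 ∨ a = 2 → ∃ s, c s = a

noncomputable def patK (M : Finset ℤ) (S : Finset ℕ) (A : Finset ℕ) : ℕ :=
  Nat.card {c : S → Finset ℤ × ℕ //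
    ((∀ s, (c s).1 ⊆ M ∧ (c s).1.card + (c s).2 = s.1 + 1) ∧
    ∀ s t : S, s.1 ≤ t.1 → (c s).1 ⊆ (c t).1 ∧ (c s).2 ≤ (c t).2) ∧
    PatHit S A (fun s => (c s).2)}

theorem pat_part {β γ ι : Type*} (inc : β → γ → Prop) (M : Finset ℤ) (S A : Finset ℕ)
    (mk : ι → ℕ → PF β γ)
    (hrk : ∀ i, ∀ k ∈ A, (mk i k).rk = k)
    (hle : ∀ i, ∀ k ∈ A, ∀ k' ∈ A, k ≤ k' → PF.le inc (mk i k) (mk i k'))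
    (hinj : ∀ i j, (∀ a ∈ A, a = 1 ∨ a = 2 → mk i a = mk j a) → i = j)
    (hsurj : ∀ g : S → PF β γ, (∀ s t : S, s.1 ≤ t.1 → PF.le inc (g s) (g t)) →
      PatHit S A (fun s => (g s).rk) → ∃ i, ∀ s, g s = mk i (g s).rk) :
    Nat.card {c : S → Finset ℤ × PF β γ // ((∀ s : S, plp M (c s) s.1) ∧
      ∀ s t : S, s.1 ≤ t.1 → plle inc (c s) (c t)) ∧ PatHit S A (fun s => (c s).2.rk)} =
    patK M S A * Nat.card ι := by
  unfold patK
  rw [← Nat.card_prod]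
  symm
  refine Nat.card_congr (Equiv.ofBijective
    (fun x => ⟨fun s => ((x.1.1 s).1, mk x.2 (x.1.1 s).2), ?_⟩) ⟨?_, ?_⟩)
  · obtain ⟨⟨c, ⟨h1, h2⟩, h3⟩, i⟩ := x
    have hr : ∀ s, (mk i (c s).2).rk = (c s).2 := fun s => hrk i _ (h3.1 s)
    refine ⟨⟨fun s => ⟨(h1 s).1, ?_⟩, fun s t hst => ⟨(h2 s t hst).1, ?_⟩⟩, ?_⟩
    · simpa [hr] using (h1 s).2
    · exact hle i _ (h3.1 s) _ (h3.1 t) (h2 s t hst).2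
    · simpa [hr] using h3
  · rintro ⟨⟨c, ⟨h1, h2⟩, h3⟩, i⟩ ⟨⟨c', ⟨h1', h2'⟩, h3'⟩, j⟩ h
    have h := congrArg Subtype.val h
    have hc : c = c' := by
      funext s
      have hs := congrFun h s
      simp only [Prod.mk.injEq] at hs
      ext1
      · exact hs.1
      · exact (hrk i _ (h3.1 s)).symm.trans ((congrArg PF.rk hs.2).trans (hrk j _ (h3'.1 s)))
    subst hc
    have : i = j := by
      apply hinj
      intro a ha hh
      obtain ⟨s, hs⟩ := h3.2 a ha hh
      have h' := congrFun h s
      simp only [Prod.mk.injEq] at h'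
      rw [← hs]
      exact h'.2
    subst this
    rfl
  · rintro ⟨c, ⟨h1, h2⟩, h3⟩
    obtain ⟨i, hi⟩ := hsurj (fun s => (c s).2) (fun s t hst => (h2 s t hst).2) h3
    refine ⟨⟨⟨fun s => ((c s).1, (c s).2.rk), ⟨fun s => h1 s, fun s t hst =>
      ⟨(h2 s t hst).1, PF.le_rk (h2 s t hst).2⟩⟩, h3⟩, i⟩, ?_⟩
    apply Subtype.ext
    funext s
    ext1
    · rfl
    · exact (hi s).symm

theorem plp_finite {β γ : Type*} [Finite β] [Finite γ] (M : Finset ℤ) (s : ℕ) :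
    {x : Finset ℤ × PF β γ | plp M x s}.Finite := by
  have : Finite (PF β γ) := by
    refine Finite.of_injective (β := Option (Option (β ⊕ γ))) (fun x => match x with
      | .bot => none
      | .top => some none
      | .vert a => some (some (Sum.inl a))
      | .edge a => some (some (Sum.inr a))) ?_
    intro x y h
    cases x <;> cases y <;> simp_all
  refine Set.Finite.subset ((M.powerset.finite_toSet).prod (Set.finite_univ (α := PF β γ))) ?_
  intro x hx
  simpa using hx.1

theorem cnt_pl {β γ : Type*} [Finite β] [Finite γ] (inc : β → γ → Prop) (M : Finset ℤ)
    (S : Finset ℕ) :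
    cnt (plp M) (plle inc) S = patK M S {0,3} + patK M S {0,1,3} * Nat.card β
      + patK M S {0,2,3} * Nat.card γ
      + patK M S {0,1,2,3} * Nat.card {x : β × γ // inc x.1 x.2} := by
  classical
  have e0 := pat_part (ι := Unit) inc M S {0,3} (fun _ k => if k = 0 then .bot else .top)
    (by simp [PF.rk]) (by simp [PF.le]) (by simp) (by
      intro g hg ⟨h, _⟩
      refine ⟨(), fun s => ?_⟩
      have := h s
      rcases hh : g s <;> simp_all [PF.rk])
  have e1 := pat_part (ι := β) inc M S {0,1,3}
    (fun i k => if k = 0 then .bot else if k = 1 then .vert i else .top)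
    (by simp [PF.rk]) (by simp [PF.le]) (by simp) (by
      intro g hg ⟨h, h'⟩
      obtain ⟨s0, hs0⟩ := h' 1 (by simp) (by simp)
      rcases hh0 : g s0 with _ | b | _ | _ <;> simp [hh0, PF.rk] at hs0
      refine ⟨b, fun s => ?_⟩
      have := h s
      rcases hh : g s with _ | b' | _ | _ <;> simp [hh, PF.rk] at this ⊢
      rcases le_total s.1 s0.1 with hl | hl
      · have := hg _ _ hl
        simpa [hh, hh0, PF.le] using this
      · have := hg _ _ hl
        simpa [hh, hh0, PF.le, eq_comm] using this)
  have e2 := pat_part (ι := γ) inc M S {0,2,3}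
    (fun i k => if k = 0 then .bot else if k = 2 then .edge i else .top)
    (by simp [PF.rk]) (by simp [PF.le]) (by simp) (by
      intro g hg ⟨h, h'⟩
      obtain ⟨s0, hs0⟩ := h' 2 (by simp) (by simp)
      rcases hh0 : g s0 with _ | _ | b | _ <;> simp [hh0, PF.rk] at hs0
      refine ⟨b, fun s => ?_⟩
      have := h s
      rcases hh : g s with _ | _ | b' | _ <;> simp [hh, PF.rk] at this ⊢
      rcases le_total s.1 s0.1 with hl | hl
      · have := hg _ _ hl
        simpa [hh, hh0, PF.le] using this
      · have := hg _ _ hl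
        simpa [hh, hh0, PF.le, eq_comm] using this)
  have e3 := pat_part (ι := {x : β × γ // inc x.1 x.2}) inc M S {0,1,2,3}
    (fun i k => if k = 0 then .bot else if k = 1 then .vert i.1.1 else
      if k = 2 then .edge i.1.2 else .top)
    (by simp [PF.rk]) (by rintro ⟨i, hi⟩; simp [PF.le, hi])
    (by rintro ⟨⟨i, i'⟩, hi⟩ ⟨⟨j, j'⟩, hj⟩; simp) (by
      intro g hg ⟨h, h'⟩
      obtain ⟨s0, hs0⟩ := h' 1 (by simp) (by simp)
      obtain ⟨s1, hs1⟩ := h' 2 (by simp) (by simp)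
      rcases hh0 : g s0 with _ | a | _ | _ <;> simp [hh0, PF.rk] at hs0
      rcases hh1 : g s1 with _ | _ | b | _ <;> simp [hh1, PF.rk] at hs1
      have hab : inc a b := by
        rcases le_total s0.1 s1.1 with hl | hl
        · have := hg _ _ hl
          simpa [hh1, hh0, PF.le] using this
        · have := hg _ _ hl
          simp [hh1, hh0, PF.le] at this
      refine ⟨⟨(a, b), hab⟩, fun s => ?_⟩
      rcases hh : g s with _ | a' | b' | _ <;> simp [PF.rk]
      · rcases le_total s.1 s0.1 with hl | hl
        · have := hg _ _ hl
          simpa [hh, hh0, PF.le] using this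
        · have := hg _ _ hl
          simpa [hh, hh0, PF.le, eq_comm] using this
      · rcases le_total s.1 s1.1 with hl | hl
        · have := hg _ _ hl
          simpa [hh, hh1, PF.le] using this
        · have := hg _ _ hl
          simpa [hh, hh1, PF.le, eq_comm] using this)
  rw [Nat.card_unique (α := Unit), mul_one] at e0
  rw [← e0, ← e1, ← e2, ← e3]
  have hfin := chain_finite (p := plp (β := β) (γ := γ) M) (plle inc) (S := S)
    (fun s _ => plp_finite M s)
  have key : ∀ (α : Type _) (p q0 q1 q2 q3 : α → Prop) (_ : Finite {x // p x}),
      (∀ x, (q0 x ∨ q1 x ∨ q2 x ∨ q3 x)) →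
      (∀ x, ¬ (q0 x ∧ q1 x) ∧ ¬ (q0 x ∧ q2 x) ∧ ¬ (q0 x ∧ q3 x) ∧ ¬ (q1 x ∧ q2 x) ∧
        ¬ (q1 x ∧ q3 x) ∧ ¬ (q2 x ∧ q3 x)) →
      Nat.card {x // p x} = Nat.card {x // p x ∧ q0 x} + Nat.card {x // p x ∧ q1 x} +
        Nat.card {x // p x ∧ q2 x} + Nat.card {x // p x ∧ q3 x} := by
    intro α p q0 q1 q2 q3 hf h h'
    have hf : {x | p x}.Finite := hf
    have hs : ∀ q : α → Prop, {x | p x ∧ q x}.Finite := fun q => hf.subset (fun x hx => hx.1)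
    change Nat.card ↥{x | p x} = Nat.card ↥{x | p x ∧ q0 x} + Nat.card ↥{x | p x ∧ q1 x} +
      Nat.card ↥{x | p x ∧ q2 x} + Nat.card ↥{x | p x ∧ q3 x}
    simp only [Nat.card_coe_set_eq]
    have : {x | p x} = (({x | p x ∧ q0 x} ∪ {x | p x ∧ q1 x}) ∪ {x | p x ∧ q2 x}) ∪
        {x | p x ∧ q3 x} := by
      ext x
      have := h x
      simp only [Set.mem_union, Set.mem_ofPred_eq]
      tauto
    rw [this, Set.ncard_union_eq ?_ (((hs _).union (hs _)).union (hs _)) (hs _),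
      Set.ncard_union_eq ?_ ((hs _).union (hs _)) (hs _), Set.ncard_union_eq ?_ (hs _) (hs _)]
    · rw [Set.disjoint_left]; intro x hx hx'; exact (h' x).1 ⟨hx.2, hx'.2⟩
    · rw [Set.disjoint_left]; intro x hx hx'
      have := h' x
      simp only [Set.mem_union, Set.mem_ofPred_eq] at hx hx'
      tauto
    · rw [Set.disjoint_left]; intro x hx hx'
      have := h' x
      simp only [Set.mem_union, Set.mem_ofPred_eq] at hx hx'
      tauto
  have hle3 : ∀ x : PF β γ, x.rk = 0 ∨ x.rk = 1 ∨ x.rk = 2 ∨ x.rk = 3 := by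
    intro x; cases x <;> simp [PF.rk]
  refine key _ _ _ _ _ _ hfin ?_ ?_
  · intro c
    have hc : ∀ s, _ := fun s => hle3 (c s).2
    simp only [PatHit, Finset.mem_insert, Finset.mem_singleton]
    by_cases h1 : ∃ s, (c s).2.rk = 1 <;> by_cases h2 : ∃ s, (c s).2.rk = 2
    · right; right; right
      exact ⟨hc, by rintro a - (rfl | rfl) <;> assumption⟩
    · right; left
      push Not at h2
      refine ⟨fun s => ?_, ?_⟩
      · have := hc s; have := h2 s; tauto
      · rintro a h (rfl | rfl)
        · exact h1
        · omega
    · right; right; left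
      push Not at h1
      refine ⟨fun s => ?_, ?_⟩
      · have := hc s; have := h1 s; tauto
      · rintro a h (rfl | rfl)
        · omega
        · exact h2
    · left
      push Not at h1 h2
      refine ⟨fun s => ?_, ?_⟩
      · have := hc s; have := h1 s; have := h2 s; tauto
      · rintro a h (rfl | rfl) <;> omega
  · intro c
    have aux : ∀ (A A' : Finset ℕ) (a : ℕ), a = 1 ∨ a = 2 → a ∈ A → a ∉ A' →
        ¬ (PatHit S A' (fun s => (c s).2.rk) ∧ PatHit S A (fun s => (c s).2.rk)) := by
      rintro A A' a ha h1 h2 ⟨h3, h4⟩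
      obtain ⟨s, hs⟩ := h4.2 a h1 ha
      exact h2 (hs ▸ h3.1 s)
    refine ⟨aux _ _ 1 ?_ ?_ ?_, aux _ _ 2 ?_ ?_ ?_, aux _ _ 1 ?_ ?_ ?_, aux _ _ 2 ?_ ?_ ?_,
      aux _ _ 2 ?_ ?_ ?_, aux _ _ 1 ?_ ?_ ?_⟩ <;> simp


/-- Tokens for faces of the multiplex: `(false, V)` is the simplex on the vertex set `V`,
`(true, I)` is the intersection of the facets with index in `I`. -/
abbrev Tok := Bool × Finset ℤ

def tle (d : ℕ) (x y : Tok) : Prop :=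
  (x.1 = false ∧ y.1 = false ∧ x.2 ⊆ y.2) ∨ (x.1 = true ∧ y.1 = true ∧ y.2 ⊆ x.2) ∨
  (x.1 = false ∧ y.1 = true ∧ ∀ i ∈ x.2, ∀ j ∈ y.2, i ≠ j ∧ i - j ≤ (d : ℤ) - 1 ∧
    j - i ≤ (d : ℤ) - 1)

def tokp (d n : ℕ) (x : Tok) (s : ℕ) : Prop :=
  x.2.Nonempty ∧
  ((x.1 = false ∧ x.2.card = s + 1 ∧ (∀ i ∈ x.2, 0 ≤ i ∧ i ≤ (n : ℤ)) ∧
      ∀ i ∈ x.2, ∀ j ∈ x.2, j - i ≤ (d : ℤ) - 2 ∨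
        (j - i = (d : ℤ) - 1 ∧ (i = 0 ∨ j = (n : ℤ)))) ∨
   (x.1 = true ∧ x.2.card + s = d ∧ (∀ i ∈ x.2, 1 ≤ i ∧ i ≤ (n : ℤ) - 1) ∧
      ∀ i ∈ x.2, ∀ j ∈ x.2, j - i ≤ (d : ℤ) - 2))

def genp (d : ℕ) (lo : ℤ) (x : Tok) (s : ℕ) : Prop :=
  x.2.Nonempty ∧ ((x.1 = false ∧ x.2.card = s + 1) ∨ (x.1 = true ∧ x.2.card + s = d)) ∧
  (∀ i ∈ x.2, lo ≤ i ∧ i ≤ (d : ℤ)) ∧ ∀ i ∈ x.2, ∀ j ∈ x.2, j - i ≤ (d : ℤ) - 2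

theorem tok_pair {d : ℕ} {S : Finset ℕ} {c : S → Tok}
    (hc : ∀ s t : S, s.1 ≤ t.1 → tle d (c s) (c t))
    (hd : ∀ s, ∀ i ∈ (c s).2, ∀ j ∈ (c s).2, j - i ≤ (d : ℤ) - 1)
    (s t : S) (i j : ℤ) (hi : i ∈ (c s).2) (hj : j ∈ (c t).2) :
    j - i ≤ (d : ℤ) - 1 ∧ i - j ≤ (d : ℤ) - 1 := by
  have key : ∀ (s t : S) (i j : ℤ) (_ : i ∈ (c s).2) (_ : j ∈ (c t).2), s.1 ≤ t.1 →
      j - i ≤ (d : ℤ) - 1 ∧ i - j ≤ (d : ℤ) - 1 := by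
    intro s t i j hi hj hst
    rcases hc s t hst with ⟨_, _, h⟩ | ⟨_, _, h⟩ | ⟨_, _, h⟩
    · exact ⟨hd t _ (h hi) _ hj, hd t _ hj _ (h hi)⟩
    · exact ⟨hd s _ hi _ (h hj), hd s _ (h hj) _ hi⟩
    · have := h i hi j hj
      exact ⟨this.2.2, this.2.1⟩
  rcases le_total s.1 t.1 with h | h
  · exact key s t i j hi hj h
  · exact (key t s j i hj hi h).symm

theorem tokp_diam {d n : ℕ} {x : Tok} {s : ℕ} (h : tokp d n x s) :
    ∀ i ∈ x.2, ∀ j ∈ x.2, j - i ≤ (d : ℤ) - 1 := by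
  intro i hi j hj
  rcases h.2 with h | h
  · have := h.2.2.2 i hi j hj; omega
  · have := h.2.2.2 i hi j hj; omega

theorem tok_finite {p : Tok → ℕ → Prop} {s : ℕ} (lo hi : ℤ)
    (h : ∀ x, p x s → ∀ i ∈ x.2, lo ≤ i ∧ i ≤ hi) : {x | p x s}.Finite := by
  refine Set.Finite.subset ((Set.finite_univ (α := Bool)).prod
    ((Finset.Icc lo hi).powerset.finite_toSet)) ?_
  intro x hx
  simp only [Set.mem_prod, Set.mem_univ, true_and, Finset.coe_powerset, Set.mem_preimage]
  intro i hi
  have := h x hx i hi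
  simpa using this

theorem tokp_range {d n : ℕ} {x : Tok} {s : ℕ} (h : tokp d n x s) :
    ∀ i ∈ x.2, 0 ≤ i ∧ i ≤ (n : ℤ) := by
  intro i hi
  rcases h.2 with h | h
  · exact h.2.2.1 i hi
  · have := h.2.2.1 i hi; omega

theorem tok_step (d n : ℕ) (hdn : d ≤ n) (S : Finset ℕ) :
    cnt (tokp d (n+1)) (tle d) S + cnt (genp d 2) (tle d) S =
      cnt (tokp d n) (tle d) S + cnt (genp d 1) (tle d) S := by
  have a1 := cnt_split (p := tokp d (n+1)) (le := tle d) (S := S) (fun x => (0:ℤ) ∈ x.2)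
    (fun s _ => tok_finite 0 ((n+1 : ℕ) : ℤ) (fun x hx => tokp_range hx))
  have a2 := cnt_split (p := tokp d n) (le := tle d) (S := S) (fun x => (0:ℤ) ∈ x.2)
    (fun s _ => tok_finite 0 (n : ℤ) (fun x hx => tokp_range hx))
  have a3 := cnt_split (p := fun x s => tokp d (n+1) x s ∧ (0:ℤ) ∉ x.2) (le := tle d) (S := S)
    (fun x => (1:ℤ) ∈ x.2)
    (fun s _ => tok_finite (p := fun x s => tokp d (n+1) x s ∧ (0:ℤ) ∉ x.2) (s := s) 0
      ((n+1 : ℕ) : ℤ) (fun x hx => tokp_range hx.1))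
  have a4 := cnt_split (p := genp d 1) (le := tle d) (S := S) (fun x => (1:ℤ) ∈ x.2)
    (fun s _ => tok_finite 1 (d : ℤ) (fun x hx => hx.2.2.1))
  have b1 : cntEx (tokp d (n+1)) (tle d) (fun x => (0:ℤ) ∈ x.2) S =
      cntEx (tokp d n) (tle d) (fun x => (0:ℤ) ∈ x.2) S := by
    apply cntEx_congr
    rintro c hc ⟨s0, hs0⟩
    constructor
    · intro h s
      have hr : ∀ i ∈ (c s).2, i ≤ (d : ℤ) - 1 := fun i hi => by
        have := tok_pair hc (fun s => tokp_diam (h s)) s0 s 0 i hs0 hi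
        omega
      refine ⟨(h s).1, ?_⟩
      rcases (h s).2 with ⟨h1, h2, h3, h4⟩ | ⟨h1, h2, h3, h4⟩
      · left
        refine ⟨h1, h2, fun i hi => ?_, fun i hi j hj => ?_⟩
        · have := hr i hi; have := h3 i hi; omega
        · have := hr j hj; have := h4 i hi j hj; omega
      · right
        refine ⟨h1, h2, fun i hi => ?_, h4⟩
        have := hr i hi; have := h3 i hi; omega
    · intro h s
      have hr : ∀ i ∈ (c s).2, i ≤ (d : ℤ) - 1 := fun i hi => by
        have := tok_pair hc (fun s => tokp_diam (h s)) s0 s 0 i hs0 hi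
        omega
      refine ⟨(h s).1, ?_⟩
      rcases (h s).2 with ⟨h1, h2, h3, h4⟩ | ⟨h1, h2, h3, h4⟩
      · left
        refine ⟨h1, h2, fun i hi => ?_, fun i hi j hj => ?_⟩
        · have := hr i hi; have := h3 i hi; omega
        · have := hr j hj; have := h4 i hi j hj; omega
      · right
        refine ⟨h1, h2, fun i hi => ?_, h4⟩
        have := hr i hi; have := h3 i hi; omega
  have b2 : cntEx (fun x s => tokp d (n+1) x s ∧ (0:ℤ) ∉ x.2) (tle d) (fun x => (1:ℤ) ∈ x.2) S =
      cntEx (genp d 1) (tle d) (fun x => (1:ℤ) ∈ x.2) S := by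
    apply cntEx_congr
    rintro c hc ⟨s0, hs0⟩
    constructor
    · intro h s
      have hr : ∀ i ∈ (c s).2, i ≤ (d : ℤ) := fun i hi => by
        have := tok_pair hc (fun s => tokp_diam (h s).1) s0 s 1 i hs0 hi
        omega
      have h0 : ∀ i ∈ (c s).2, i ≠ 0 := fun i hi h' => (h s).2 (h' ▸ hi)
      refine ⟨(h s).1.1, ?_⟩
      rcases (h s).1.2 with ⟨h1, h2, h3, h4⟩ | ⟨h1, h2, h3, h4⟩
      · refine ⟨Or.inl ⟨h1, h2⟩, fun i hi => ?_, fun i hi j hj => ?_⟩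
        · have := hr i hi; have := h3 i hi; have := h0 i hi; omega
        · have := hr j hj; have := h4 i hi j hj; have := h0 i hi; omega
      · refine ⟨Or.inr ⟨h1, h2⟩, fun i hi => ?_, h4⟩
        have := hr i hi; have := h3 i hi; omega
    · intro h s
      obtain ⟨h0, h1, h2, h3⟩ := h s
      refine ⟨⟨h0, ?_⟩, fun h => by have := h2 0 h; omega⟩
      rcases h1 with h1 | h1
      · refine Or.inl ⟨h1.1, h1.2, fun i hi => ?_, fun i hi j hj => Or.inl (h3 i hi j hj)⟩
        have := h2 i hi; omega
      · refine Or.inr ⟨h1.1, h1.2, fun i hi => ?_, h3⟩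
        have := h2 i hi; omega
  have b3 : cnt (fun x s => genp d 1 x s ∧ (1:ℤ) ∉ x.2) (tle d) S = cnt (genp d 2) (tle d) S := by
    refine cnt_congr id ?_ ?_ (by simp) (by simp)
    · rintro x s - ⟨⟨h0, h1, h2, h3⟩, h4⟩
      refine ⟨h0, h1, fun i hi => ?_, h3⟩
      have : i ≠ 1 := fun h => h4 (h ▸ hi)
      have := h2 i hi
      simp only [id] at *
      omega
    · rintro x s - ⟨h0, h1, h2, h3⟩
      refine ⟨x, ⟨⟨h0, h1, fun i hi => ?_, h3⟩, fun h => ?_⟩, rfl⟩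
      · have := h2 i hi; omega
      · have := h2 1 h; omega
  have b4 : cnt (fun x s => tokp d n x s ∧ (0:ℤ) ∉ x.2) (tle d) S =
      cnt (fun x s => (tokp d (n+1) x s ∧ (0:ℤ) ∉ x.2) ∧ (1:ℤ) ∉ x.2) (tle d) S := by
    have hm : ∀ (X : Finset ℤ) (k i : ℤ), i ∈ X.map (addRightEmbedding k) ↔ i - k ∈ X := by
      intro X k i
      simp only [Finset.mem_map, addRightEmbedding_apply]
      constructor
      · rintro ⟨a, ha, rfl⟩; simpa using ha
      · intro h; exact ⟨_, h, by ring⟩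
    have hsub : ∀ (X Y : Finset ℤ) (k : ℤ),
        X.map (addRightEmbedding k) ⊆ Y.map (addRightEmbedding k) ↔ X ⊆ Y :=
      fun X Y k => Finset.map_subset_map
    refine cnt_congr (fun x => (x.1, x.2.map (addRightEmbedding 1))) ?_ ?_ ?_ ?_
    · rintro ⟨b, X⟩ s - ⟨⟨h0, h⟩, h'⟩
      have h0' : ∀ i ∈ X, i ≠ 0 := fun i hi e => h' (e ▸ hi)
      simp only [tokp, hm, Finset.card_map, Finset.map_nonempty] at *
      refine ⟨⟨⟨h0, ?_⟩, ?_⟩, ?_⟩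
      · rcases h with ⟨h1, h2, h3, h4⟩ | ⟨h1, h2, h3, h4⟩
        · left
          refine ⟨h1, h2, fun i hi => ?_, fun i hi j hj => ?_⟩
          · have := h3 _ hi; push_cast; omega
          · have := h4 _ hi _ hj; have := h0' _ hi; push_cast; omega
        · right
          refine ⟨h1, h2, fun i hi => ?_, fun i hi j hj => ?_⟩
          · have := h3 _ hi; push_cast; omega
          · have := h4 _ hi _ hj; omega
      · intro hi
        rcases h with ⟨h1, h2, h3, h4⟩ | ⟨h1, h2, h3, h4⟩ <;> (have := h3 _ hi; omega)
      · exact h'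
    · rintro ⟨b, X⟩ s - ⟨⟨⟨h0, h⟩, h'⟩, h''⟩
      have h0' : ∀ i ∈ X, i ≠ 0 := fun i hi e => h' (e ▸ hi)
      have h1' : ∀ i ∈ X, i ≠ 1 := fun i hi e => h'' (e ▸ hi)
      refine ⟨(b, X.map (addRightEmbedding (-1))), ?_, ?_⟩
      · simp only [tokp, hm, Finset.card_map, Finset.map_nonempty] at *
        refine ⟨⟨h0, ?_⟩, ?_⟩
        · rcases h with ⟨h1, h2, h3, h4⟩ | ⟨h1, h2, h3, h4⟩
          · left
            refine ⟨h1, h2, fun i hi => ?_, fun i hi j hj => ?_⟩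
            · have := h3 _ hi; have := h0' _ hi; push_cast at *; omega
            · have := h4 _ hi _ hj; have := h0' _ hi; push_cast at *; omega
          · right
            refine ⟨h1, h2, fun i hi => ?_, fun i hi j hj => ?_⟩
            · have := h3 _ hi; have := h1' _ hi; push_cast at *; omega
            · have := h4 _ hi _ hj; omega
        · exact h''
      · ext1
        · rfl
        · ext i
          simp [hm]
    · rintro ⟨b, X⟩ ⟨b', X'⟩ s - - - h
      simp only [Prod.mk.injEq, Finset.map_inj] at h
      rw [h.1, h.2]
    · rintro ⟨b, X⟩ ⟨b', X'⟩ s - t - - - -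
      simp only [tle, hsub]
      have : (∀ i ∈ X, ∀ j ∈ X', i ≠ j ∧ i - j ≤ (d : ℤ) - 1 ∧ j - i ≤ (d : ℤ) - 1) ↔
        (∀ i ∈ X.map (addRightEmbedding 1), ∀ j ∈ X'.map (addRightEmbedding 1),
          i ≠ j ∧ i - j ≤ (d : ℤ) - 1 ∧ j - i ≤ (d : ℤ) - 1) := by
        simp
      rw [this]
  beta_reduce at *
  omega


theorem cnt_congr' {α β : Type*} {p : α → ℕ → Prop} {q : β → ℕ → Prop} {le : α → α → Prop}
    {le' : β → β → Prop} {S : Finset ℕ} (f : α → β)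
    (hanti : ∀ x y, le x y → le y x → x = y) (hrefl : ∀ x, le' x x)
    (hp : ∀ x, ∀ s ∈ S, p x s → q (f x) s)
    (hs : ∀ y, ∀ s ∈ S, q y s → ∃ x, p x s ∧ f x = y)
    (hle : ∀ x y, ∀ s ∈ S, ∀ t ∈ S, s ≤ t → p x s → p y t → (le x y ↔ le' (f x) (f y))) :
    cnt p le S = cnt q le' S := by
  refine cnt_congr f hp hs ?_ hle
  intro x y s hs hx hy h
  exact hanti _ _ ((hle x y s hs s hs le_rfl hx hy).2 (h ▸ hrefl _))
    ((hle y x s hs s hs le_rfl hy hx).2 (h ▸ hrefl _))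

theorem plle_anti {β γ : Type*} (inc : β → γ → Prop) (x y : Finset ℤ × PF β γ)
    (h : plle inc x y) (h' : plle inc y x) : x = y := by
  obtain ⟨J, g⟩ := x
  obtain ⟨J', g'⟩ := y
  obtain ⟨h1, h2⟩ := h
  obtain ⟨h1', h2'⟩ := h'
  have : J = J' := Finset.Subset.antisymm h1 h1'
  cases g <;> cases g' <;> simp_all [PF.le]

theorem tle_refl (d : ℕ) (x : Tok) : tle d x x := by
  rcases x with ⟨_ | _, X⟩ <;> simp [tle]

def genMap (M D : Finset ℤ) (x : Finset ℤ × PF D D) : Tok :=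
  match x.2 with
  | .bot => (false, x.1)
  | .vert a => (false, insert a.1 x.1)
  | .edge b => (true, insert b.1 (M \ x.1))
  | .top => (true, M \ x.1)

theorem gen_pl (d : ℕ) (hd : 2 ≤ d) (lo : ℤ) (hlo : lo = 1 ∨ lo = 2) (D : Finset ℤ)
    (hD : ∀ i, i ∈ D ↔ lo ≤ i ∧ (i = 1 ∨ i = (d : ℤ))) (S : Finset ℕ)
    (hS : ∀ s ∈ S, s < d) :
    cnt (plp (Finset.Icc (2:ℤ) (d-1))) (plle (fun a b : D => a ≠ b)) S
      = cnt (genp d lo) (tle d) S := by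
  set M := Finset.Icc (2:ℤ) (d-1) with hMdef
  have hM : ∀ i, i ∈ M ↔ 2 ≤ i ∧ i ≤ (d:ℤ) - 1 := fun i => by simp [hMdef]
  have hMc : M.card = d - 2 := by
    simp [hMdef]
    omega
  have hDM : ∀ i ∈ D, i ∉ M := by
    intro i hi hi'
    rw [hD] at hi; rw [hM] at hi'
    omega
  refine cnt_congr' (genMap M D) (plle_anti _) (tle_refl d) ?_ ?_ ?_
  · rintro ⟨J, g⟩ s hs ⟨h1, h2⟩
    have hsd := hS s hs
    simp only at h1 h2
    have hJ : J.card ≤ d - 2 := hMc ▸ Finset.card_le_card h1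
    have hJM : (M \ J).card + J.card = d - 2 := by
      rw [← hMc]; exact Finset.card_sdiff_add_card_eq_card h1
    rcases g with _ | a | b | _ <;> simp only [PF.rk] at h2 <;> simp only [genMap, genp]
    · refine ⟨Finset.card_pos.1 (by omega), Or.inl ⟨trivial, by omega⟩, ?_, ?_⟩
      · intro i hi
        have := (hM i).1 (h1 hi); omega
      · intro i hi j hj
        have := (hM i).1 (h1 hi); have := (hM j).1 (h1 hj); omega
    · have haM := hDM a.1 a.2
      have haJ : a.1 ∉ J := fun h => haM (h1 h)
      have haD := (hD _).1 a.2
      have hr : ∀ i ∈ insert a.1 J, i = a.1 ∨ (2 ≤ i ∧ i ≤ (d:ℤ) - 1) := by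
        intro i hi
        rcases Finset.mem_insert.1 hi with h | h
        · exact Or.inl h
        · exact Or.inr ((hM i).1 (h1 h))
      refine ⟨Finset.insert_nonempty _ _, Or.inl ⟨trivial, ?_⟩, ?_, ?_⟩
      · rw [Finset.card_insert_of_notMem haJ]; omega
      · intro i hi
        have := hr i hi; omega
      · intro i hi j hj
        have := hr i hi; have := hr j hj; omega
    · have haM := hDM b.1 b.2
      have haJ : b.1 ∉ M \ J := fun h => haM (Finset.mem_sdiff.1 h).1
      have haD := (hD _).1 b.2
      have hr : ∀ i ∈ insert b.1 (M \ J), i = b.1 ∨ (2 ≤ i ∧ i ≤ (d:ℤ) - 1) := by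
        intro i hi
        rcases Finset.mem_insert.1 hi with h | h
        · exact Or.inl h
        · exact Or.inr ((hM i).1 (Finset.mem_sdiff.1 h).1)
      refine ⟨Finset.insert_nonempty _ _, Or.inr ⟨trivial, ?_⟩, ?_, ?_⟩
      · rw [Finset.card_insert_of_notMem haJ]; omega
      · intro i hi
        have := hr i hi; omega
      · intro i hi j hj
        have := hr i hi; have := hr j hj; omega
    · have hr : ∀ i ∈ M \ J, (2 ≤ i ∧ i ≤ (d:ℤ) - 1) := by
        intro i hi
        exact ((hM i).1 (Finset.mem_sdiff.1 hi).1)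
      refine ⟨Finset.card_pos.1 (by omega), Or.inr ⟨trivial, by omega⟩, ?_, ?_⟩
      · intro i hi
        have := hr i hi; omega
      · intro i hi j hj
        have := hr i hi; have := hr j hj; omega
  · rintro ⟨b, X⟩ s hs ⟨h0, h1, h2, h3⟩
    have hsd := hS s hs
    simp only at h0 h1 h2 h3
    have hX : ∀ i ∈ X, i ∈ D ∨ i ∈ M := by
      intro i hi
      have := h2 i hi
      rw [hD, hM]; omega
    have huniq : ∀ i ∈ X, ∀ j ∈ X, i ∈ D → j ∈ D → i = j := by
      intro i hi j hj hi' hj'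
      rw [hD] at hi' hj'
      have := h3 i hi j hj; have := h3 j hj i hi
      omega
    by_cases hex : ∃ i ∈ X, i ∈ D
    · obtain ⟨i, hi, hiD⟩ := hex
      have hsub : X.erase i ⊆ M := by
        intro j hj
        rw [Finset.mem_erase] at hj
        rcases hX j hj.2 with h | h
        · exact absurd (huniq j hj.2 i hi h hiD) hj.1
        · exact h
      have hc := Finset.card_erase_add_one hi
      rcases h1 with ⟨rfl, h1⟩ | ⟨rfl, h1⟩
      · refine ⟨(X.erase i, .vert ⟨i, hiD⟩), ⟨hsub, ?_⟩, ?_⟩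
        · simp only [PF.rk]; omega
        · simp [genMap, Finset.insert_erase hi]
      · have hc' := Finset.card_sdiff_add_card_eq_card hsub
        refine ⟨(M \ X.erase i, .edge ⟨i, hiD⟩), ⟨Finset.sdiff_subset, ?_⟩, ?_⟩
        · simp only [PF.rk]; omega
        · simp only [genMap]
          rw [Finset.sdiff_sdiff_eq_self hsub, Finset.insert_erase hi]
    · push Not at hex
      have hsub : X ⊆ M := fun i hi => (hX i hi).resolve_left (hex i hi)
      rcases h1 with ⟨rfl, h1⟩ | ⟨rfl, h1⟩
      · refine ⟨(X, .bot), ⟨hsub, ?_⟩, ?_⟩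
        · simp only [PF.rk]; omega
        · simp [genMap]
      · have hc' := Finset.card_sdiff_add_card_eq_card hsub
        have := Finset.card_pos.2 h0
        refine ⟨(M \ X, .top), ⟨Finset.sdiff_subset, ?_⟩, ?_⟩
        · simp only [PF.rk]; omega
        · simp only [genMap]
          rw [Finset.sdiff_sdiff_eq_self hsub]
  · rintro ⟨J, g⟩ ⟨J', g'⟩ s hs t ht - ⟨h1, -⟩ ⟨h1', -⟩
    simp only at h1 h1'
    have hbd : ∀ i j : ℤ, (i ∈ D ∨ i ∈ M) → (j ∈ D ∨ j ∈ M) → i - j ≤ (d:ℤ) - 1 := by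
      intro i j hi hj
      rw [hD, hM] at hi hj
      omega
    have hmem : ∀ i ∈ J, i ∈ M := fun i hi => h1 hi
    have hmem' : ∀ i ∈ J', i ∈ M := fun i hi => h1' hi
    have ht : ∀ X Y : Finset ℤ, (∀ i ∈ X, i ∈ D ∨ i ∈ M) → (∀ i ∈ Y, i ∈ D ∨ i ∈ M) →
        (tle d (false, X) (true, Y) ↔ ∀ i ∈ X, i ∉ Y) := by
      intro X Y hX hY
      simp only [tle]
      constructor
      · intro h i hi hi'
        simp only [reduceCtorEq, false_and, and_false, true_and, false_or] at h
        exact (h i hi i hi').1 rfl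
      · intro h
        right; right
        refine ⟨trivial, trivial, fun i hi j hj => ⟨?_, hbd _ _ (hX i hi) (hY j hj),
          hbd _ _ (hY j hj) (hX i hi)⟩⟩
        rintro rfl
        exact h i hi hj
    have hff : ∀ X Y : Finset ℤ, tle d (false, X) (false, Y) ↔ X ⊆ Y := by simp [tle]
    have htt : ∀ X Y : Finset ℤ, tle d (true, X) (true, Y) ↔ Y ⊆ X := by simp [tle]
    have htf : ∀ X Y : Finset ℤ, ¬ tle d (true, X) (false, Y) := by simp [tle]
    rcases g with _ | ⟨a, ha⟩ | ⟨a, ha⟩ | _ <;> rcases g' with _ | ⟨b, hb⟩ | ⟨b, hb⟩ | _ <;>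
      simp only [genMap, plle, PF.le, hff, htt, htf, and_false, and_true]
    all_goals clear hff htt htf hmem hmem' hS hs hMc hM hlo hD
    all_goals clear_value M
    all_goals try have haM := hDM _ ha
    all_goals try have hbM := hDM _ hb
    all_goals clear hDM
    all_goals clear hMdef
    all_goals try rw [ht _ _
      (by intro i hi; clear ht hbd; (try simp only [Finset.mem_insert, Finset.mem_sdiff] at hi); grind)
      (by intro i hi; clear ht hbd; (try simp only [Finset.mem_insert, Finset.mem_sdiff] at hi); grind)]
    all_goals clear ht hbd
    all_goals simp only [Finset.subset_iff, Subtype.mk.injEq, ne_eq, Finset.mem_insert, Finset.mem_sdiff] at *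
    all_goals constructor
    all_goals intro h
    all_goals try have hx := @h a
    all_goals try have hy := @h b
    all_goals grind

def triMap (M : Finset ℤ) (T : Finset ℤ) (x : Finset ℤ × PF T T) : Finset ℤ :=
  match x.2 with
  | .bot => x.1
  | .vert a => insert a.1 x.1
  | .edge b => T.erase b.1 ∪ x.1
  | .top => T ∪ x.1

theorem tri_pl (M T : Finset ℤ) (hMT : Disjoint T M) (hT : T.card = 3) (S : Finset ℕ) :
    cnt (plp M) (plle (fun a b : T => a ≠ b)) S =
      cnt (fun (W : Finset ℤ) s => W ⊆ T ∪ M ∧ W.card = s + 1) (· ⊆ ·) S := by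
  have hTM : ∀ i ∈ T, i ∉ M := fun i hi => Finset.disjoint_left.1 hMT hi
  refine cnt_congr' (triMap M T) (plle_anti _) (fun x => Finset.Subset.refl x) ?_ ?_ ?_
  · rintro ⟨J, g⟩ s hs ⟨h1, h2⟩
    simp only at h1 h2
    have hdj : Disjoint T J := Finset.disjoint_of_subset_right h1 hMT
    rcases g with _ | a | b | _ <;> simp only [PF.rk] at h2 <;> simp only [triMap]
    · exact ⟨h1.trans Finset.subset_union_right, by omega⟩
    · refine ⟨?_, ?_⟩
      · intro i hi
        have := a.2
        grind
      · rw [Finset.card_insert_of_notMem (Finset.disjoint_left.1 hdj a.2)]; omega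
    · refine ⟨?_, ?_⟩
      · intro i hi
        grind
      · rw [Finset.card_union_of_disjoint (Finset.disjoint_of_subset_left
          (Finset.erase_subset _ _) hdj), Finset.card_erase_of_mem b.2]; omega
    · refine ⟨?_, ?_⟩
      · intro i hi
        grind
      · rw [Finset.card_union_of_disjoint hdj]; omega
  · rintro W s hs ⟨h1, h2⟩
    have hc : (W ∩ M).card + (W ∩ T).card = s + 1 := by
      rw [← h2, ← Finset.card_union_of_disjoint]
      · congr 1
        ext i
        have := @h1 i
        simp only [Finset.mem_union, Finset.mem_inter] at *
        tauto
      · rw [Finset.disjoint_left]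
        intro i hi hi'
        exact hTM i (Finset.mem_inter.1 hi').2 (Finset.mem_inter.1 hi).2
    have hWT : W ∩ T ⊆ T := Finset.inter_subset_right
    have hc3 : (T \ (W ∩ T)).card + (W ∩ T).card = 3 := by
      rw [← hT]; exact Finset.card_sdiff_add_card_eq_card hWT
    have hle : (W ∩ T).card ≤ 3 := by omega
    have hW : ∀ i, i ∈ W ↔ i ∈ W ∩ T ∨ i ∈ W ∩ M := by
      intro i
      have := @h1 i
      simp only [Finset.mem_union, Finset.mem_inter] at *
      tauto
    interval_cases hk : (W ∩ T).card
    · refine ⟨(W ∩ M, .bot), ⟨Finset.inter_subset_right, by simpa [PF.rk] using hc⟩, ?_⟩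
      rw [Finset.card_eq_zero] at hk
      ext i
      rw [hW i, hk]
      simp [triMap]
    · obtain ⟨a, ha⟩ := Finset.card_eq_one.1 hk
      have haT : a ∈ T := hWT (by simp [ha])
      refine ⟨(W ∩ M, .vert ⟨a, haT⟩), ⟨Finset.inter_subset_right, by simpa [PF.rk] using hc⟩, ?_⟩
      ext i
      rw [hW i, ha]
      simp [triMap]
    · have hk' : (T \ (W ∩ T)).card = 1 := by omega
      obtain ⟨a, ha⟩ := Finset.card_eq_one.1 hk'
      have haT : a ∈ T := Finset.sdiff_subset (by rw [ha]; simp : a ∈ T \ (W ∩ T))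
      have he : W ∩ T = T.erase a := by
        rw [← Finset.sdiff_sdiff_eq_self hWT, ha, Finset.sdiff_singleton_eq_erase]
      refine ⟨(W ∩ M, .edge ⟨a, haT⟩), ⟨Finset.inter_subset_right, by simpa [PF.rk] using hc⟩, ?_⟩
      ext i
      rw [hW i, he]
      simp only [triMap, Finset.mem_union]
    · have he : W ∩ T = T := by
        apply Finset.eq_of_subset_of_card_le hWT
        omega
      refine ⟨(W ∩ M, .top), ⟨Finset.inter_subset_right, by simpa [PF.rk] using hc⟩, ?_⟩
      ext i
      rw [hW i, he]
      simp only [triMap, Finset.mem_union]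
  · rintro ⟨J, g⟩ ⟨J', g'⟩ s hs t ht - ⟨h1, -⟩ ⟨h1', -⟩
    simp only at h1 h1'
    have hmem : ∀ i ∈ J, i ∉ T := fun i hi h => hTM i h (h1 hi)
    have hmem' : ∀ i ∈ J', i ∉ T := fun i hi h => hTM i h (h1' hi)
    have key : ∀ A A' : Finset ℤ, A ⊆ T → A' ⊆ T → (A ∪ J ⊆ A' ∪ J' ↔ J ⊆ J' ∧ A ⊆ A') := by
      intro A A' hA hA'
      constructor
      · intro h
        constructor
        · intro i hi
          have := h (Finset.mem_union_right _ hi)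
          rcases Finset.mem_union.1 this with h | h
          · exact absurd (hA' h) (hmem i hi)
          · exact h
        · intro i hi
          have := h (Finset.mem_union_left _ hi)
          rcases Finset.mem_union.1 this with h | h
          · exact h
          · exact absurd (hA hi) (hmem' i h)
      · rintro ⟨h, h'⟩
        exact Finset.union_subset_union h' h
    let sup : PF T T → Finset ℤ := fun g => match g with
      | .bot => ∅ | .vert a => {a.1} | .edge b => T.erase b.1 | .top => T
    have hsup : ∀ (g : PF T T) (J : Finset ℤ), triMap M T (J, g) = sup g ∪ J := by
      rintro (_ | a | b | _) J <;> ext i <;> simp [triMap, sup]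
    have hsT : ∀ g, sup g ⊆ T := by
      rintro (_ | a | b | _) <;> simp [sup, Finset.erase_subset]
    rw [hsup, hsup, key _ _ (hsT _) (hsT _)]
    simp only [plle]
    apply and_congr_right
    intro _
    clear hsT hsup key hmem hmem' hTM hMT h1 h1'
    obtain ⟨x, y, z, hxy, hxz, hyz, rfl⟩ := Finset.card_eq_three.1 hT
    clear hT
    rcases g with _ | ⟨a, ha⟩ | ⟨a, ha⟩ | _ <;> rcases g' with _ | ⟨b, hb⟩ | ⟨b, hb⟩ | _ <;>
      simp only [sup, PF.le, Finset.subset_iff, Finset.mem_erase, Finset.mem_insert, Finset.mem_singleton,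
        Subtype.mk.injEq, Finset.notMem_empty, ne_eq]
    all_goals try simp only [Finset.mem_insert, Finset.mem_singleton] at ha
    all_goals try simp only [Finset.mem_insert, Finset.mem_singleton] at hb
    all_goals constructor
    all_goals intro h
    all_goals try have hx := @h x
    all_goals try have hy := @h y
    all_goals try have hz := @h z
    all_goals grind


theorem tle_anti (d : ℕ) (x y : Tok) (h : tle d x y) (h' : tle d y x) : x = y := by
  obtain ⟨b, X⟩ := x
  obtain ⟨b', Y⟩ := y
  rcases b with _ | _ <;> rcases b' with _ | _ <;> simp [tle] at h h'
  · rw [Finset.Subset.antisymm h h']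
  · rw [Finset.Subset.antisymm h h']

noncomputable def simMap (d : ℕ) (x : Tok) : Finset ℤ :=
  if x.1 then Finset.Icc (0:ℤ) d \ x.2 else x.2

theorem sim_tok (d : ℕ) (hd : 2 ≤ d) (S : Finset ℕ) (hS : ∀ s ∈ S, s < d) :
    cnt (tokp d d) (tle d) S =
      cnt (fun (W : Finset ℤ) s => W ⊆ Finset.Icc (0:ℤ) d ∧ W.card = s + 1) (· ⊆ ·) S := by
  have hcI : (Finset.Icc (0:ℤ) d).card = d + 1 := by simp
  refine cnt_congr' (simMap d) (tle_anti d) (fun x => Finset.Subset.refl x) ?_ ?_ ?_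
  · rintro ⟨b, X⟩ s hs ⟨h0, ⟨rfl, h1, h2, h3⟩ | ⟨rfl, h1, h2, h3⟩⟩
    · refine ⟨?_, by simpa [simMap] using h1⟩
      intro i hi
      have := h2 i (by simpa [simMap] using hi)
      simpa using this
    · refine ⟨by simp [simMap, Finset.sdiff_subset], ?_⟩
      have hsub : X ⊆ Finset.Icc (0:ℤ) d := by
        intro i hi
        have := h2 i hi
        rw [Finset.mem_Icc]; omega
      have := Finset.card_sdiff_add_card_eq_card hsub
      simp only [simMap, if_true]
      simp only at h1
      omega
  · rintro W s hs ⟨h1, h2⟩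
    have hsd := hS s hs
    by_cases h : (0:ℤ) ∈ W ∧ (d:ℤ) ∈ W
    · refine ⟨(true, Finset.Icc (0:ℤ) d \ W), ?_, ?_⟩
      · have hc := Finset.card_sdiff_add_card_eq_card h1
        have hr : ∀ i ∈ Finset.Icc (0:ℤ) d \ W, 1 ≤ i ∧ i ≤ (d:ℤ) - 1 := by
          intro i hi
          rw [Finset.mem_sdiff, Finset.mem_Icc] at hi
          have : i ≠ 0 := by rintro rfl; exact hi.2 h.1
          have : i ≠ d := by rintro rfl; exact hi.2 h.2
          omega
        refine ⟨Finset.card_pos.1 (by simp only; omega), Or.inr ⟨rfl, by simp only; omega, hr, ?_⟩⟩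
        intro i hi j hj
        have := hr i hi; have := hr j hj; omega
      · simp only [simMap, if_true]
        exact Finset.sdiff_sdiff_eq_self h1
    · refine ⟨(false, W), ?_, by simp [simMap]⟩
      have hr : ∀ i ∈ W, 0 ≤ i ∧ i ≤ (d:ℤ) := fun i hi => by simpa using h1 hi
      refine ⟨Finset.card_pos.1 (by simp only; omega), Or.inl ⟨rfl, h2, hr, ?_⟩⟩
      intro i hi j hj
      have := hr i hi; have := hr j hj
      by_contra hcon
      have : ¬ (i = 0 ∧ j = d) := by
        rintro ⟨rfl, rfl⟩; exact h ⟨hi, hj⟩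
      omega
  · rintro ⟨b, X⟩ ⟨b', Y⟩ s hs t ht - ⟨h0, ⟨rfl, h1, h2, h3⟩ | ⟨rfl, h1, h2, h3⟩⟩
      ⟨h0', ⟨rfl, h1', h2', h3'⟩ | ⟨rfl, h1', h2', h3'⟩⟩ <;> simp only at h1 h2 h3 h1' h2' h3'
    · simp [tle, simMap]
    · simp only [tle, simMap]
      simp only [reduceCtorEq, false_and, and_false, true_and, false_or, if_true, if_false,
        Finset.subset_iff, Finset.mem_sdiff, Finset.mem_Icc, Bool.false_eq_true]
      constructor
      · intro h i hi
        exact ⟨h2 i hi, fun hi' => (h i hi i hi').1 rfl⟩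
      · intro h i hi j hj
        have := h2 i hi; have := h2' j hj
        refine ⟨?_, by omega, by omega⟩
        rintro rfl
        exact (@h i hi).2 hj
    · simp only [tle, simMap]
      simp only [reduceCtorEq, false_and, and_false, false_or, if_true, false_iff]
      intro h
      have ha : (0:ℤ) ∈ Y := by
        simpa using h (Finset.mem_sdiff.2 ⟨by simp, fun hc => by have := h2 _ hc; omega⟩ :
          (0:ℤ) ∈ Finset.Icc (0:ℤ) d \ X)
      have hb : (d:ℤ) ∈ Y := by
        simpa using h (Finset.mem_sdiff.2 ⟨by simp, fun hc => by have := h2 _ hc; omega⟩ :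
          (d:ℤ) ∈ Finset.Icc (0:ℤ) d \ X)
      have := h3' _ ha _ hb
      omega
    · simp only [tle, simMap]
      simp only [reduceCtorEq, false_and, and_false, false_or, true_and, or_false, if_true]
      constructor
      · intro h
        exact Finset.sdiff_subset_sdiff (Finset.Subset.refl _) h
      · intro h i hi
        by_contra hc
        have := h2' i hi
        have := h (Finset.mem_sdiff.2 ⟨Finset.mem_Icc.2 (by omega), hc⟩)
        exact (Finset.mem_sdiff.1 this).2 hi

theorem card_ne (D : Finset ℤ) :
    Nat.card {x : D × D // x.1 ≠ x.2} = D.card * D.card - D.card := by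
  rw [Nat.card_eq_fintype_card, Fintype.card_subtype_compl (fun x : D × D => x.1 = x.2)]
  congr 1
  · simp
  · rw [Fintype.card_subtype]
    rw [← Finset.card_univ.trans (Fintype.card_coe D)]
    symm
    apply Finset.card_bij (fun a _ => (a, a)) <;> simp

theorem tok_count (d n : ℕ) (hd : 2 ≤ d) (hdn : d ≤ n) (S : Finset ℕ) (hS : ∀ s ∈ S, s < d) :
    cnt (tokp d n) (tle d) S =
      patK (Finset.Icc (2:ℤ) (d-1)) S {0,3} + patK (Finset.Icc (2:ℤ) (d-1)) S {0,1,3} * (n - d + 3)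
      + patK (Finset.Icc (2:ℤ) (d-1)) S {0,2,3} * (n - d + 3)
      + patK (Finset.Icc (2:ℤ) (d-1)) S {0,1,2,3} * (2 * (n - d + 3)) := by
  have g1 := gen_pl d hd 1 (Or.inl rfl) ({1, (d:ℤ)} : Finset ℤ) (by intro i; simp; omega) S hS
  have g2 := gen_pl d hd 2 (Or.inr rfl) ({(d:ℤ)} : Finset ℤ) (by intro i; simp; omega) S hS
  have hT3 : ({0, 1, (d:ℤ)} : Finset ℤ).card = 3 :=
    Finset.card_eq_three.2 ⟨0, 1, d, by simp, by omega, by omega, rfl⟩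
  have hT2 : ({1, (d:ℤ)} : Finset ℤ).card = 2 := Finset.card_pair (by omega)
  have g3 := tri_pl (Finset.Icc (2:ℤ) (d-1)) ({0, 1, (d:ℤ)} : Finset ℤ) (by
    rw [Finset.disjoint_left]; intro i; simp; omega) hT3 S
  have hU : ({0, 1, (d:ℤ)} : Finset ℤ) ∪ Finset.Icc (2:ℤ) (d-1) = Finset.Icc 0 (d:ℤ) := by
    ext i; simp; omega
  rw [hU, ← sim_tok d hd S hS] at g3
  rw [cnt_pl, card_ne] at g1 g2 g3
  simp only [Nat.card_eq_fintype_card, Fintype.card_coe, hT3, hT2, Finset.card_singleton] at g1 g2 g3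
  induction n, hdn using Nat.le_induction with
  | base => rw [← g3]; simp
  | succ n hdn ih =>
    have := tok_step d n hdn S
    rw [ih, ← g1, ← g2] at this
    have e : n + 1 - d + 3 = (n - d + 3) + 1 := by omega
    rw [e]
    generalize n - d + 3 = N at *
    simp only [Nat.reduceMul, Nat.reduceSub, mul_zero] at this
    nlinarith


section geom
variable {E : Type*} [NormedAddCommGroup E] [NormedSpace ℝ E]

theorem hull_slice (X : Set E) (l : E →L[ℝ] ℝ) (c : ℝ) (h : ∀ x ∈ X, l x ≤ c) :
    {p ∈ convexHull ℝ X | l p = c} = convexHull ℝ {x ∈ X | l x = c} := by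
  have hW : convexHull ℝ {x ∈ X | l x = c} ⊆ {p | l p = c} :=
    convexHull_min (fun x hx => hx.2) (convex_hyperplane l.toLinearMap.isLinear c)
  apply Set.Subset.antisymm
  · have hconv : Convex ℝ ({p | l p < c} ∪ convexHull ℝ {x ∈ X | l x = c}) := by
      have hle : ∀ p ∈ ({p | l p < c} ∪ convexHull ℝ {x ∈ X | l x = c}), l p ≤ c := by
        rintro p (hp | hp)
        · exact le_of_lt hp
        · exact le_of_eq (hW hp)
      intro p hp q hq a b ha hb hab
      by_cases hlt : l (a • p + b • q) < c
      · exact Or.inl hlt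
      have hp' := hle p hp
      have hq' := hle q hq
      simp only [map_add, map_smul, smul_eq_mul, not_lt] at hlt
      rcases eq_or_lt_of_le ha with ha0 | ha0
      · have : b = 1 := by linarith
        subst this
        simpa [← ha0] using hq
      rcases eq_or_lt_of_le hb with hb0 | hb0
      · have : a = 1 := by linarith
        subst this
        simpa [← hb0] using hp
      have h1 : l p = c := by
        by_contra hne
        have : l p < c := lt_of_le_of_ne hp' hne
        have hcc : a * c + b * c = c := by rw [← add_mul, hab, one_mul]
        nlinarith [mul_lt_mul_of_pos_left this ha0, mul_le_mul_of_nonneg_left hq' hb]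
      have h2 : l q = c := by
        by_contra hne
        have : l q < c := lt_of_le_of_ne hq' hne
        have hcc : a * c + b * c = c := by rw [← add_mul, hab, one_mul]
        nlinarith [mul_lt_mul_of_pos_left this hb0, mul_le_mul_of_nonneg_left hp' ha]
      right
      have hp2 : p ∈ convexHull ℝ {x ∈ X | l x = c} := hp.resolve_left (by simp [h1])
      have hq2 : q ∈ convexHull ℝ {x ∈ X | l x = c} := hq.resolve_left (by simp [h2])
      exact convex_convexHull ℝ _ hp2 hq2 ha hb hab
    have hX : convexHull ℝ X ⊆ {p | l p < c} ∪ convexHull ℝ {x ∈ X | l x = c} := by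
      refine convexHull_min ?_ hconv
      intro x hx
      rcases eq_or_lt_of_le (h x hx) with h' | h'
      · exact Or.inr (subset_convexHull ℝ _ ⟨hx, h'⟩)
      · exact Or.inl h'
    rintro p ⟨hp, hpc⟩
    exact (hX hp).resolve_left (by simp [hpc])
  · intro p hp
    exact ⟨convexHull_mono (fun x hx => hx.1) hp, hW hp⟩

theorem hull_le (X : Set E) (l : E →L[ℝ] ℝ) (c : ℝ) (h : ∀ x ∈ X, l x ≤ c) :
    ∀ p ∈ convexHull ℝ X, l p ≤ c := by
  intro p hp
  exact convexHull_min (t := {p | l p ≤ c}) h (convex_halfSpace_le l.toLinearMap.isLinear c) hp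

theorem face_mk (X : Set E) (l : E →L[ℝ] ℝ) (c : ℝ) (h : ∀ x ∈ X, l x ≤ c)
    (h' : ∃ x ∈ X, l x = c) : IsFaceOf (convexHull ℝ X) (convexHull ℝ {x ∈ X | l x = c}) := by
  obtain ⟨w, hw, hwc⟩ := h'
  refine ⟨fun _ => ⟨l, ?_⟩, ⟨w, subset_convexHull ℝ _ ⟨hw, hwc⟩⟩⟩
  rw [← hull_slice X l c h]
  ext p
  constructor
  · rintro ⟨hp, hpc⟩
    exact ⟨hp, fun y hy => hpc ▸ hull_le X l c h y hy⟩
  · rintro ⟨hp, hpm⟩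
    exact ⟨hp, le_antisymm (hull_le X l c h p hp) (hwc ▸ hpm w (subset_convexHull ℝ _ hw))⟩

theorem face_dest {X F : Set E} (hF : IsFaceOf (convexHull ℝ X) F) :
    ∃ (l : E →L[ℝ] ℝ) (c : ℝ), (∀ x ∈ X, l x ≤ c) ∧ (∃ x ∈ X, l x = c) ∧
      F = convexHull ℝ {x ∈ X | l x = c} ∧ F = {p ∈ convexHull ℝ X | l p = c} ∧
      ∀ p ∈ convexHull ℝ X, p ∉ F → l p < c := by
  obtain ⟨hF1, hF2⟩ := hF
  obtain ⟨l, hl⟩ := hF1 hF2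
  obtain ⟨p, hp⟩ := hF2
  have hp' := hl ▸ hp
  have h : ∀ x ∈ X, l x ≤ l p := fun x hx => hp'.2 x (subset_convexHull ℝ _ hx)
  have hFs : F = {q ∈ convexHull ℝ X | l q = l p} := by
    rw [hl]
    ext q
    constructor
    · rintro ⟨hq, hqm⟩
      exact ⟨hq, le_antisymm (hp'.2 q hq) (hqm p hp'.1)⟩
    · rintro ⟨hq, hqe⟩
      exact ⟨hq, fun y hy => hqe ▸ hp'.2 y hy⟩
  have hFW : F = convexHull ℝ {x ∈ X | l x = l p} := by rw [hFs, hull_slice X l _ h]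
  refine ⟨l, l p, h, ?_, hFW, hFs, ?_⟩
  · rw [hFW] at hp
    have : (convexHull ℝ {x ∈ X | l x = l p}).Nonempty := ⟨p, hp⟩
    obtain ⟨x, hx, hx'⟩ := convexHull_nonempty_iff.1 this
    exact ⟨x, hx, hx'⟩
  · intro q hq hqF
    refine lt_of_le_of_ne (hp'.2 q hq) fun h => hqF ?_
    rw [hFs]
    exact ⟨hq, h⟩

theorem face_subset {P F : Set E} (hF : IsFaceOf P F) : F ⊆ P := hF.1.subset

theorem face_hull {X F : Set E} (hF : IsFaceOf (convexHull ℝ X) F) :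
    F = convexHull ℝ (X ∩ F) := by
  obtain ⟨l, c, h, -, h1, h2, -⟩ := face_dest hF
  have : X ∩ F = {x ∈ X | l x = c} := by
    ext x
    rw [h2]
    constructor
    · rintro ⟨hx, -, hx'⟩; exact ⟨hx, hx'⟩
    · rintro ⟨hx, hx'⟩; exact ⟨hx, subset_convexHull ℝ _ hx, hx'⟩
  rw [this, ← h1]

theorem face_mono {X F G : Set E} (hF : IsFaceOf (convexHull ℝ X) F)
    (hG : IsFaceOf (convexHull ℝ X) G) : F ⊆ G ↔ X ∩ F ⊆ X ∩ G := by
  constructor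
  · exact fun h => Set.inter_subset_inter_right _ h
  · intro h
    rw [face_hull hF, face_hull hG]
    exact convexHull_mono h

theorem face_self {X : Set E} (hX : X.Nonempty) : IsFaceOf (convexHull ℝ X) (convexHull ℝ X) := by
  have := face_mk X 0 0 (by simp) (by obtain ⟨x, hx⟩ := hX; exact ⟨x, hx, by simp⟩)
  simpa using this

theorem pdim_convexHull (X : Set E) : pdim (convexHull ℝ X) = pdim X := by
  rw [pdim, affineSpan_convexHull, ← pdim]

instance fd_dir (X : Set E) [hX : Finite X] :
    FiniteDimensional ℝ (affineSpan ℝ (convexHull ℝ X)).direction := by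
  rw [affineSpan_convexHull]
  exact finiteDimensional_direction_affineSpan_of_finite ℝ hX

theorem pdim_mono {X F G : Set E} (hX : X.Finite) (h : F ⊆ G) (hG : G ⊆ convexHull ℝ X) :
    pdim F ≤ pdim G := by
  have : Finite X := hX
  have h1 : (affineSpan ℝ G).direction ≤ (affineSpan ℝ (convexHull ℝ X)).direction :=
    AffineSubspace.direction_le (affineSpan_mono ℝ hG)
  have := Submodule.finiteDimensional_of_le h1
  exact Submodule.finrank_mono (AffineSubspace.direction_le (affineSpan_mono ℝ h))

theorem face_pdim_lt {X F G : Set E} (hX : X.Finite) (hF : IsFaceOf (convexHull ℝ X) F)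
    (hG : IsFaceOf (convexHull ℝ X) G) (h : F ⊂ G) : pdim F < pdim G := by
  have : Finite X := hX
  obtain ⟨l, c, -, ⟨w, hw, hwc⟩, -, h2, h3⟩ := face_dest hF
  have h1 : (affineSpan ℝ G).direction ≤ (affineSpan ℝ (convexHull ℝ X)).direction :=
    AffineSubspace.direction_le (affineSpan_mono ℝ (face_subset hG))
  have := Submodule.finiteDimensional_of_le h1
  obtain ⟨q, hqG, hqF⟩ := Set.exists_of_ssubset h
  have hwF : w ∈ F := by rw [h2]; exact ⟨subset_convexHull ℝ _ hw, hwc⟩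
  refine Submodule.finrank_lt_finrank_of_lt (lt_of_le_of_ne
    (AffineSubspace.direction_le (affineSpan_mono ℝ h.1)) ?_)
  intro heq
  have hq : q - w ∈ (affineSpan ℝ F).direction := by
    rw [heq]
    exact AffineSubspace.vsub_mem_direction (subset_affineSpan ℝ _ hqG)
      (subset_affineSpan ℝ _ (h.1 hwF))
  have hk : (affineSpan ℝ F).direction ≤ LinearMap.ker l.toLinearMap := by
    rw [direction_affineSpan, vectorSpan_def, Submodule.span_le]
    rintro _ ⟨a, ha, b, hb, rfl⟩
    rw [h2] at ha hb
    simp [ha.2, hb.2]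
  have := hk hq
  have h4 := h3 q (face_subset hG hqG) hqF
  simp at this
  linarith

theorem ext_cont (W : Submodule ℝ E) [FiniteDimensional ℝ W] (φ : E →ₗ[ℝ] ℝ) :
    ∃ g : E →L[ℝ] ℝ, ∀ w ∈ W, g w = φ w := by
  obtain ⟨g, hg, -⟩ := exists_extension_norm_eq W
    (LinearMap.toContinuousLinearMap (φ ∘ₗ W.subtype))
  exact ⟨g, fun w hw => by simpa using hg ⟨w, hw⟩⟩

theorem face_rotate {X F : Set E} (hX : X.Finite) (hF : IsFaceOf (convexHull ℝ X) F)
    (hd : pdim F + 1 < pdim (convexHull ℝ X)) (v : E) (hv : v ∈ X) (hvF : v ∉ F) :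
    ∃ G, IsFaceOf (convexHull ℝ X) G ∧ F ⊂ G ∧ v ∉ G := by
  have : Finite X := hX
  obtain ⟨l, c, hl, ⟨w, hw, hwc⟩, h1, h2, h3⟩ := face_dest hF
  have hwF : w ∈ F := by rw [h2]; exact ⟨subset_convexHull ℝ _ hw, hwc⟩
  set D := (affineSpan ℝ (convexHull ℝ X)).direction with hD
  have hFD : (affineSpan ℝ F).direction ≤ D :=
    AffineSubspace.direction_le (affineSpan_mono ℝ (face_subset hF))
  have := Submodule.finiteDimensional_of_le hFD
  set U := (affineSpan ℝ F).direction ⊔ Submodule.span ℝ {v - w} with hU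
  have hUr : Module.finrank ℝ U < Module.finrank ℝ D := by
    have e1 := Submodule.finrank_add_le_finrank_add_finrank
      (affineSpan ℝ F).direction (Submodule.span ℝ {v - w})
    have e2 := finrank_span_le_card (R := ℝ) ({v - w} : Set E)
    rw [Set.toFinset_singleton, Finset.card_singleton] at e2
    rw [← hU] at e1
    have e3 : pdim F = Module.finrank ℝ (affineSpan ℝ F).direction := rfl
    have e4 : pdim (convexHull ℝ X) = Module.finrank ℝ D := rfl
    omega
  obtain ⟨u, huD, huU⟩ : ∃ u ∈ D, u ∉ U := by
    by_contra hcon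
    push Not at hcon
    exact absurd (Submodule.finrank_mono (show D ≤ U from hcon)) (by omega)
  obtain ⟨φ, hφ2, hφ1⟩ := Submodule.exists_le_ker_of_notMem huU
  obtain ⟨g0, hg0⟩ := ext_cont D φ
  have hxD : ∀ x ∈ X, x - w ∈ D := fun x hx =>
    AffineSubspace.vsub_mem_direction (subset_affineSpan ℝ _ (subset_convexHull ℝ _ hx))
      (subset_affineSpan ℝ _ (subset_convexHull ℝ _ hw))
  have key : ∃ g : E →L[ℝ] ℝ, (∀ x ∈ X, x ∈ F → g (x - w) = 0) ∧ g (v - w) = 0 ∧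
      ∃ x ∈ X, 0 < g (x - w) := by
    have a1 : ∀ x ∈ X, x ∈ F → g0 (x - w) = 0 := by
      intro x hx hxF
      rw [hg0 _ (hxD x hx)]
      apply hφ1
      exact Submodule.mem_sup_left (AffineSubspace.vsub_mem_direction (subset_affineSpan ℝ _ hxF)
        (subset_affineSpan ℝ _ hwF))
    have a2 : g0 (v - w) = 0 := by
      rw [hg0 _ (hxD v hv)]
      apply hφ1
      exact Submodule.mem_sup_right (Submodule.mem_span_singleton_self _)
    have a3 : ∃ x ∈ X, g0 (x - w) ≠ 0 := by
      by_contra hcon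
      push Not at hcon
      apply hφ2
      rw [← hg0 u huD]
      have : D ≤ LinearMap.ker g0.toLinearMap := by
        rw [hD, affineSpan_convexHull, direction_affineSpan, vectorSpan_eq_span_vsub_set_right ℝ hw,
          Submodule.span_le]
        rintro _ ⟨x, hx, rfl⟩
        simpa using hcon x hx
      simpa using this huD
    obtain ⟨x, hx, hne⟩ := a3
    rcases lt_or_gt_of_ne hne with h | h
    · refine ⟨-g0, fun x hx hxF => ?_, ?_, x, hx, ?_⟩
      · rw [neg_apply, a1 x hx hxF, neg_zero]
      · rw [neg_apply, a2, neg_zero]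
      · rw [neg_apply]; linarith
    · exact ⟨g0, a1, a2, x, hx, h⟩
  obtain ⟨g, g1, g2, x1, hx1, hx1p⟩ := key
  obtain ⟨m, ⟨hmX, hmp⟩, hmin⟩ := Set.exists_min_image {x ∈ X | 0 < g (x - w)}
    (fun x => (c - l x) / g (x - w)) (hX.subset (fun x hx => hx.1)) ⟨x1, hx1, hx1p⟩
  set t := (c - l m) / g (m - w) with ht
  have ht0 : 0 ≤ t := div_nonneg (by linarith [hl m hmX]) hmp.le
  have hmF : m ∉ F := fun h => by rw [g1 m hmX h] at hmp; exact lt_irrefl _ hmp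
  have htm : t * g (m - w) = c - l m := div_mul_cancel₀ _ hmp.ne'
  have hval : ∀ x, (l + t • g) x = l x + t * g (x - w) + t * g w := by
    intro x
    simp [mul_sub]
    ring
  have hle : ∀ x ∈ X, (l + t • g) x ≤ c + t * g w := by
    intro x hx
    rw [hval]
    by_cases hpos : 0 < g (x - w)
    · have := hmin x ⟨hx, hpos⟩
      have := (le_div_iff₀ hpos).1 this
      linarith
    · have := hl x hx
      nlinarith
  have hG := face_mk X (l + t • g) (c + t * g w) hle ⟨m, hmX, by rw [hval]; linarith⟩
  have hGs := hull_slice X (l + t • g) (c + t * g w) hle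
  refine ⟨_, hG, ⟨?_, ?_⟩, ?_⟩
  · rw [face_mono hF hG]
    rintro x ⟨hx, hxF⟩
    refine ⟨hx, subset_convexHull ℝ _ ⟨hx, ?_⟩⟩
    rw [hval, g1 x hx hxF]
    rw [h2] at hxF
    rw [hxF.2]; ring
  · intro hsub
    apply hmF
    apply hsub
    apply subset_convexHull ℝ _
    refine ⟨hmX, ?_⟩
    rw [hval]; linarith
  · rw [← hGs]
    rintro ⟨hvP, hvc⟩
    rw [hval, g2] at hvc
    have := h3 v hvP hvF
    linarith

theorem face_facet {X F : Set E} (hX : X.Finite) (hF : IsFaceOf (convexHull ℝ X) F)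
    (v : E) (hv : v ∈ X) (hvF : v ∉ F) :
    ∃ G, IsFaceOf (convexHull ℝ X) G ∧ F ⊆ G ∧ v ∉ G ∧ pdim G + 1 = pdim (convexHull ℝ X) := by
  induction hk : pdim (convexHull ℝ X) - pdim F using Nat.strong_induction_on generalizing F with
  | _ k ih =>
    have hvP := subset_convexHull ℝ X hv
    have hlt := face_pdim_lt hX hF (face_self ⟨v, hv⟩)
      ⟨face_subset hF, fun h => hvF (h hvP)⟩
    by_cases hd : pdim F + 1 < pdim (convexHull ℝ X)
    · obtain ⟨G, hG, hFG, hvG⟩ := face_rotate hX hF hd v hv hvF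
      have := face_pdim_lt hX hF hG hFG
      obtain ⟨H, h1, h2, h3, h4⟩ := ih _ (by omega) hG hvG rfl
      exact ⟨H, h1, hFG.1.trans h2, h3, h4⟩
    · exact ⟨F, hF, Subset.rfl, hvF, by omega⟩

end geom


def mR (d n : ℕ) (i j : ℤ) : Prop :=
  i - j ≤ (d:ℤ) - 1 ∧ j - i ≤ (d:ℤ) - 1 ∧ ¬ (i = j ∧ 0 < i ∧ i < (n:ℤ))

theorem mR_symm {d n : ℕ} {i j : ℤ} : mR d n i j ↔ mR d n j i := by
  unfold mR; constructor <;> intro h <;> omega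

open Classical in
noncomputable def mdual (d n : ℕ) (I : Finset ℤ) : Finset ℤ :=
  (Finset.Icc (0:ℤ) n).filter (fun j => ∀ i ∈ I, mR d n i j)

theorem mem_mdual {d n : ℕ} {I : Finset ℤ} {j : ℤ} :
    j ∈ mdual d n I ↔ (0 ≤ j ∧ j ≤ (n:ℤ)) ∧ ∀ i ∈ I, mR d n i j := by
  simp [mdual]

def TB (d n : ℕ) (V : Finset ℤ) : Prop :=
  V.Nonempty ∧ (∀ i ∈ V, 0 ≤ i ∧ i ≤ (n : ℤ)) ∧
    ∀ i ∈ V, ∀ j ∈ V, j - i ≤ (d : ℤ) - 2 ∨ (j - i = (d : ℤ) - 1 ∧ (i = 0 ∨ j = (n : ℤ)))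

def TA (d n : ℕ) (I : Finset ℤ) : Prop :=
  I.Nonempty ∧ (∀ i ∈ I, 1 ≤ i ∧ i ≤ (n : ℤ) - 1) ∧ ∀ i ∈ I, ∀ j ∈ I, j - i ≤ (d : ℤ) - 2

theorem TA.tb {d n : ℕ} {I : Finset ℤ} (h : TA d n I) : TB d n I :=
  ⟨h.1, fun i hi => by have := h.2.1 i hi; omega, fun i hi j hj => Or.inl (h.2.2 i hi j hj)⟩

theorem TB.sub {d n : ℕ} {V W : Finset ℤ} (h : TB d n V) (hW : W ⊆ V) (hne : W.Nonempty) :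
    TB d n W :=
  ⟨hne, fun i hi => h.2.1 i (hW hi), fun i hi j hj => h.2.2 i (hW hi) j (hW hj)⟩

theorem TA.sub {d n : ℕ} {V W : Finset ℤ} (h : TA d n V) (hW : W ⊆ V) (hne : W.Nonempty) :
    TA d n W :=
  ⟨hne, fun i hi => h.2.1 i (hW hi), fun i hi j hj => h.2.2 i (hW hi) j (hW hj)⟩

theorem TB.sep {d n : ℕ} (hd : 2 ≤ d) (hdn : d ≤ n) {V : Finset ℤ} (h : TB d n V) (j : ℤ)
    (hj : 0 ≤ j ∧ j ≤ (n:ℤ)) (hjV : j ∉ V) :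
    ∃ i : ℤ, (0 ≤ i ∧ i ≤ (n:ℤ)) ∧ (∀ v ∈ V, mR d n i v) ∧ ¬ mR d n i j := by
  obtain ⟨hne, hr, hB⟩ := h
  set a := V.min' hne with ha
  set b := V.max' hne with hb
  have haV : a ∈ V := V.min'_mem hne
  have hbV : b ∈ V := V.max'_mem hne
  have hal : ∀ v ∈ V, a ≤ v := fun v hv => V.min'_le v hv
  have hbl : ∀ v ∈ V, v ≤ b := fun v hv => V.le_max' v hv
  have har := hr a haV
  have hbr := hr b hbV
  have hab := hB a haV b hbV
  have hjv : ∀ v ∈ V, j ≠ v := fun v hv h => hjV (h ▸ hv)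
  clear_value a b
  unfold mR
  by_cases h1 : a + d ≤ j
  · by_cases h0 : a = 0
    · refine ⟨0, by omega, fun v hv => ?_, by omega⟩
      have := hal v hv; have := hbl v hv; omega
    · refine ⟨a - 1, by omega, fun v hv => ?_, by omega⟩
      have := hal v hv; have := hbl v hv; omega
  by_cases h2 : j + d ≤ b
  · by_cases h0 : b = n
    · refine ⟨n, by omega, fun v hv => ?_, by omega⟩
      have := hal v hv; have := hbl v hv; omega
    · refine ⟨b + 1, by omega, fun v hv => ?_, by omega⟩
      have := hal v hv; have := hbl v hv; omega
  by_cases hjn : j = n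
  · refine ⟨n - d, by omega, fun v hv => ?_, by omega⟩
    have := hal v hv; have := hbl v hv; have := hjv v hv; have := hr v hv; omega
  by_cases hj0 : j = 0
  · refine ⟨d, by omega, fun v hv => ?_, by omega⟩
    have := hal v hv; have := hbl v hv; have := hjv v hv; have := hr v hv; omega
  refine ⟨j, by omega, fun v hv => ?_, by omega⟩
  have := hal v hv; have := hbl v hv; have := hjv v hv; have := hr v hv; omega

theorem TB.exists_notMem {d n : ℕ} (hdn : d ≤ n) {V : Finset ℤ} (h : TB d n V) :
    ∃ j : ℤ, (0 ≤ j ∧ j ≤ (n:ℤ)) ∧ j ∉ V := by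
  by_contra hcon
  push Not at hcon
  have := h.2.2 0 (hcon 0 (by omega)) n (hcon n (by omega))
  omega

theorem TB.dual_nonempty {d n : ℕ} (hd : 2 ≤ d) (hdn : d ≤ n) {V : Finset ℤ} (h : TB d n V) :
    (mdual d n V).Nonempty := by
  obtain ⟨j, hj, hjV⟩ := h.exists_notMem hdn
  obtain ⟨i, hi, hiV, -⟩ := h.sep hd hdn j hj hjV
  exact ⟨i, mem_mdual.2 ⟨hi, fun v hv => mR_symm.1 (hiV v hv)⟩⟩

theorem TB.dual_dual {d n : ℕ} (hd : 2 ≤ d) (hdn : d ≤ n) {V : Finset ℤ} (h : TB d n V) :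
    mdual d n (mdual d n V) = V := by
  ext j
  rw [mem_mdual]
  constructor
  · rintro ⟨hj, hjI⟩
    by_contra hjV
    obtain ⟨i, hi, hiV, hij⟩ := h.sep hd hdn j hj hjV
    exact hij (hjI i (mem_mdual.2 ⟨hi, fun v hv => mR_symm.1 (hiV v hv)⟩))
  · intro hj
    exact ⟨h.2.1 j hj, fun i hi => mR_symm.1 ((mem_mdual.1 hi).2 j hj)⟩

theorem dual_TA {d n : ℕ} {V : Finset ℤ} (hr : ∀ i ∈ V, 0 ≤ i ∧ i ≤ (n : ℤ))
    (hV : V.Nonempty) (h : ¬ TB d n V) (hI : (mdual d n V).Nonempty) : TA d n (mdual d n V) := by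
  have : ∃ i ∈ V, ∃ j ∈ V, ¬ (j - i ≤ (d : ℤ) - 2 ∨
      (j - i = (d : ℤ) - 1 ∧ (i = 0 ∨ j = (n : ℤ)))) := by
    by_contra hcon
    push Not at hcon
    exact h ⟨hV, hr, fun i hi j hj => by have := hcon i hi j hj; omega⟩
  obtain ⟨i, hi, j, hj, hij⟩ := this
  have hri := hr i hi
  have hrj := hr j hj
  have key : ∀ k ∈ mdual d n V, (0 ≤ k ∧ k ≤ (n:ℤ)) ∧ mR d n i k ∧ mR d n j k := by
    intro k hk
    have := mem_mdual.1 hk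
    exact ⟨this.1, this.2 i hi, this.2 j hj⟩
  unfold mR at key
  refine ⟨hI, fun k hk => ?_, fun k hk k' hk' => ?_⟩
  · have := key k hk; omega
  · have := key k hk; have := key k' hk'; omega

theorem TA.spread {d n : ℕ} (hd : 2 ≤ d) (hdn : d ≤ n) {I : Finset ℤ} (h : TA d n I) :
    ∃ a ∈ mdual d n I, ∃ b ∈ mdual d n I, a + d ≤ b := by
  obtain ⟨hne, hr, hB⟩ := h
  set p := I.min' hne with hp
  set q := I.max' hne with hq
  have hpI : p ∈ I := I.min'_mem hne
  have hqI : q ∈ I := I.max'_mem hne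
  have hpl : ∀ v ∈ I, p ≤ v := fun v hv => I.min'_le v hv
  have hql : ∀ v ∈ I, v ≤ q := fun v hv => I.le_max' v hv
  have hpr := hr p hpI
  have hqr := hr q hqI
  have hpq := hB p hpI q hqI
  clear_value p q
  refine ⟨max 0 (q - d + 1), ?_, min n (p + d - 1), ?_, ?_⟩
  · rw [mem_mdual]
    refine ⟨by omega, fun i hi => ?_⟩
    have := hpl i hi; have := hql i hi; have := hr i hi
    unfold mR; omega
  · rw [mem_mdual]
    refine ⟨by omega, fun i hi => ?_⟩
    have := hpl i hi; have := hql i hi; have := hr i hi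
    unfold mR; omega
  · have := hpl q hqI
    omega

theorem TA.window {d n : ℕ} (hd : 2 ≤ d) (hdn : d ≤ n) {I : Finset ℤ} (h : TA d n I) :
    ∃ W, TA d n W ∧ I ⊆ W ∧ W.card = d - 1 := by
  obtain ⟨hne, hr, hB⟩ := h
  set p := I.min' hne with hp
  have hpI : p ∈ I := I.min'_mem hne
  have hpl : ∀ v ∈ I, p ≤ v := fun v hv => I.min'_le v hv
  have hpr := hr p hpI
  clear_value p
  have hsub : I ⊆ Finset.Icc (min p (n - d + 1)) (min p (n - d + 1) + d - 2) := by
    intro i hi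
    have := hpl i hi; have := hr i hi; have := hB p hpI i hi
    rw [Finset.mem_Icc]; omega
  refine ⟨Finset.Icc (min p (n - d + 1)) (min p (n - d + 1) + d - 2), ⟨hne.mono hsub, ?_, ?_⟩,
    hsub, ?_⟩
  · intro i hi
    rw [Finset.mem_Icc] at hi; omega
  · intro i hi j hj
    rw [Finset.mem_Icc] at hi hj; omega
  · rw [Int.card_Icc]; omega


section multi
variable {E : Type*} [NormedAddCommGroup E] [NormedSpace ℝ E]
variable {d n : ℕ} {P : Set E} {x : ℤ → E}

/-- convex hull of the vertices with index in `V` -/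
def fc (x : ℤ → E) (V : Finset ℤ) : Set E := convexHull ℝ (x '' (V : Set ℤ))

theorem fc_mem (hM : IsMultiplex d n P x) {V : Finset ℤ} (hV : ∀ i ∈ V, 0 ≤ i ∧ i ≤ (n : ℤ))
    {j : ℤ} (hj : 0 ≤ j ∧ j ≤ (n : ℤ)) : x j ∈ fc x V ↔ j ∈ V := by
  constructor
  · intro h
    have hsub : fc x V ⊆ P := by
      rw [hM.hull]
      exact convexHull_mono (Set.image_mono fun i hi => hV i hi)
    have h1 : x j ∈ Set.extremePoints ℝ P := by
      rw [hM.verts]; exact ⟨j, hj, rfl⟩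
    have h2 : x j ∈ Set.extremePoints ℝ (fc x V) :=
      inter_extremePoints_subset_extremePoints_of_subset hsub ⟨h, h1⟩
    obtain ⟨i, hi, hij⟩ := extremePoints_convexHull_subset h2
    have := hM.inj (hV i hi) hj hij
    exact this ▸ hi
  · intro h
    exact subset_convexHull ℝ _ ⟨j, h, rfl⟩

theorem fc_sub (hM : IsMultiplex d n P x) {V W : Finset ℤ} (hV : ∀ i ∈ V, 0 ≤ i ∧ i ≤ (n : ℤ))
    (hW : ∀ i ∈ W, 0 ≤ i ∧ i ≤ (n : ℤ)) : fc x V ⊆ fc x W ↔ V ⊆ W := by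
  constructor
  · intro h i hi
    exact (fc_mem hM hW (hV i hi)).1 (h ((fc_mem hM hV (hV i hi)).2 hi))
  · intro h
    exact convexHull_mono (Set.image_mono h)

theorem facet_eq (hM : IsMultiplex d n P x) {i : ℤ} (hi : 0 ≤ i ∧ i ≤ (n : ℤ)) :
    convexHull ℝ (x '' (Icc (i - d + 1) (i + d - 1) \ {i})) = fc x (mdual d n {i}) := by
  have hd := hM.two_le_d
  have hdn := hM.d_le_n
  unfold fc
  congr 1
  ext p
  constructor
  · rintro ⟨j, ⟨⟨hj1, hj2⟩, hj3⟩, rfl⟩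
    have hj3' : j ≠ i := hj3
    rcases lt_trichotomy j 0 with h | h | h
    · refine ⟨0, ?_, (hM.clamp_lo j h.le).symm⟩
      rw [Finset.mem_coe, mem_mdual]
      simp only [Finset.mem_singleton, forall_eq]
      unfold mR; omega
    · subst h
      refine ⟨0, ?_, rfl⟩
      rw [Finset.mem_coe, mem_mdual]
      simp only [Finset.mem_singleton, forall_eq]
      unfold mR; omega
    · by_cases hjn : j < n
      · refine ⟨j, ?_, rfl⟩
        rw [Finset.mem_coe, mem_mdual]
        simp only [Finset.mem_singleton, forall_eq]
        unfold mR; omega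
      · refine ⟨n, ?_, (hM.clamp_hi j (by omega)).symm⟩
        rw [Finset.mem_coe, mem_mdual]
        simp only [Finset.mem_singleton, forall_eq]
        unfold mR; omega
  · rintro ⟨j, hj, rfl⟩
    rw [Finset.mem_coe, mem_mdual] at hj
    simp only [Finset.mem_singleton, forall_eq] at hj
    unfold mR at hj
    by_cases hji : j = i
    · by_cases h0 : i = 0
      · refine ⟨-1, ⟨⟨by omega, by omega⟩, ?_⟩, ?_⟩
        · simp only [Set.mem_singleton_iff]; omega
        · rw [hM.clamp_lo _ (by omega), hji, h0]
      · refine ⟨n + 1, ⟨⟨by omega, by omega⟩, ?_⟩, ?_⟩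
        · simp only [Set.mem_singleton_iff]; omega
        · rw [hM.clamp_hi _ (by omega), hji]
          congr 1; omega
    · exact ⟨j, ⟨⟨by omega, by omega⟩, hji⟩, rfl⟩

theorem facet_face (hM : IsMultiplex d n P x) {i : ℤ} (hi : 0 ≤ i ∧ i ≤ (n : ℤ)) :
    IsFaceOf P (fc x (mdual d n {i})) ∧ pdim (fc x (mdual d n {i})) = d - 1 := by
  rw [hM.facets]
  exact ⟨i, hi, (facet_eq hM hi).symm⟩

theorem face_facet_sep (hM : IsMultiplex d n P x) {F : Set E} (hF : IsFaceOf P F) {j : ℤ}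
    (hj : 0 ≤ j ∧ j ≤ (n : ℤ)) (hjF : x j ∉ F) :
    ∃ i : ℤ, (0 ≤ i ∧ i ≤ (n : ℤ)) ∧ F ⊆ fc x (mdual d n {i}) ∧ ¬ mR d n i j := by
  have hd := hM.two_le_d
  have hX : (x '' Icc (0:ℤ) n).Finite := (Set.finite_Icc _ _).image _
  have hdim := hM.dim
  rw [hM.hull] at hF hdim
  obtain ⟨G, h1, h2, h3, h4⟩ := face_facet hX hF (x j) ⟨j, hj, rfl⟩ hjF
  rw [hdim] at h4
  rw [← hM.hull] at h1
  obtain ⟨i, hi, rfl⟩ := (hM.facets G).1 ⟨h1, by omega⟩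
  rw [facet_eq hM hi] at h2 h3
  refine ⟨i, hi, h2, fun hR => h3 ?_⟩
  rw [fc_mem hM (fun k hk => (mem_mdual.1 hk).1) hj, mem_mdual]
  refine ⟨hj, fun k hk => ?_⟩
  rw [Finset.mem_singleton] at hk
  rw [hk]; exact hR

theorem dual_range {I : Finset ℤ} : ∀ i ∈ mdual d n I, 0 ≤ i ∧ i ≤ (n : ℤ) :=
  fun _ hi => (mem_mdual.1 hi).1

theorem dual_face (hM : IsMultiplex d n P x) {I : Finset ℤ} (hI : ∀ i ∈ I, 0 ≤ i ∧ i ≤ (n : ℤ))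
    (hne : (mdual d n I).Nonempty) : IsFaceOf P (fc x (mdual d n I)) := by
  have key : ∀ i : ℤ, ∃ (l : E →L[ℝ] ℝ) (c : ℝ), i ∈ I →
      (∀ j : ℤ, (0 ≤ j ∧ j ≤ (n : ℤ)) → l (x j) ≤ c ∧ (l (x j) = c ↔ mR d n i j)) := by
    intro i
    by_cases hi : i ∈ I
    · have hF := (facet_face hM (hI i hi)).1
      rw [hM.hull] at hF
      obtain ⟨l, c, h1, -, -, h2, -⟩ := face_dest hF
      refine ⟨l, c, fun _ j hj => ⟨h1 _ ⟨j, hj, rfl⟩, ?_⟩⟩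
      have h3 := fc_mem hM (V := mdual d n {i}) dual_range hj
      rw [h2, mem_mdual] at h3
      simp only [Finset.mem_singleton, forall_eq] at h3
      constructor
      · intro h
        exact (h3.1 ⟨subset_convexHull ℝ _ ⟨j, hj, rfl⟩, h⟩).2
      · intro h
        exact (h3.2 ⟨hj, h⟩).2
    · exact ⟨0, 0, fun h => absurd h hi⟩
  choose l c hlc using key
  have hval : ∀ j : ℤ, (0 ≤ j ∧ j ≤ (n : ℤ)) →
      ((∑ i ∈ I, l i) (x j) ≤ ∑ i ∈ I, c i ∧
        ((∑ i ∈ I, l i) (x j) = ∑ i ∈ I, c i ↔ ∀ i ∈ I, mR d n i j)) := by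
    intro j hj
    rw [sum_apply]
    refine ⟨Finset.sum_le_sum fun i hi => (hlc i hi j hj).1, ?_⟩
    rw [Finset.sum_eq_sum_iff_of_le fun i hi => (hlc i hi j hj).1]
    exact forall₂_congr fun i hi => (hlc i hi j hj).2
  have hW : {p ∈ x '' Icc (0:ℤ) n | (∑ i ∈ I, l i) p = ∑ i ∈ I, c i}
      = x '' (mdual d n I : Set ℤ) := by
    ext p
    constructor
    · rintro ⟨⟨j, hj, rfl⟩, h⟩
      exact ⟨j, Finset.mem_coe.2 (mem_mdual.2 ⟨hj, (hval j hj).2.1 h⟩), rfl⟩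
    · rintro ⟨j, hj, rfl⟩
      have hj' := mem_mdual.1 (Finset.mem_coe.1 hj)
      exact ⟨⟨j, hj'.1, rfl⟩, (hval j hj'.1).2.2 hj'.2⟩
  unfold fc
  rw [← hW, hM.hull]
  apply face_mk
  · rintro _ ⟨j, hj, rfl⟩
    exact (hval j hj).1
  · obtain ⟨j, hj⟩ := hne
    have hj' := mem_mdual.1 hj
    exact ⟨_, ⟨j, hj'.1, rfl⟩, (hval j hj'.1).2.2 hj'.2⟩

theorem TB.face (hM : IsMultiplex d n P x) {V : Finset ℤ} (h : TB d n V) : IsFaceOf P (fc x V) := by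
  rw [← h.dual_dual hM.two_le_d hM.d_le_n]
  refine dual_face hM dual_range ?_
  rw [h.dual_dual hM.two_le_d hM.d_le_n]
  exact h.1

theorem TA.face (hM : IsMultiplex d n P x) {I : Finset ℤ} (h : TA d n I) :
    IsFaceOf P (fc x (mdual d n I)) :=
  dual_face hM h.tb.2.1 (h.tb.dual_nonempty hM.two_le_d hM.d_le_n)

theorem mface_lt (hM : IsMultiplex d n P x) {V W : Finset ℤ} (hV : ∀ i ∈ V, 0 ≤ i ∧ i ≤ (n : ℤ))
    (hW : ∀ i ∈ W, 0 ≤ i ∧ i ≤ (n : ℤ)) (h1 : IsFaceOf P (fc x V)) (h2 : IsFaceOf P (fc x W))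
    (h : V ⊂ W) : pdim (fc x V) < pdim (fc x W) := by
  have hX : (x '' Icc (0:ℤ) n).Finite := (Set.finite_Icc _ _).image _
  rw [hM.hull] at h1 h2
  refine face_pdim_lt hX h1 h2 ⟨(fc_sub hM hV hW).2 h.1, fun h' => h.2 ((fc_sub hM hW hV).1 h')⟩

theorem TB.dim (hM : IsMultiplex d n P x) {V : Finset ℤ} (h : TB d n V) :
    pdim (fc x V) + 1 = V.card := by
  apply le_antisymm
  · unfold fc
    rw [pdim_convexHull, pdim, direction_affineSpan]
    have hc := Finset.card_pos.2 h.1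
    classical
    have := finrank_vectorSpan_image_finset_le ℝ x V (n := V.card - 1) (by omega)
    rw [Finset.coe_image] at this
    omega
  · induction hk : V.card using Nat.strong_induction_on generalizing V with
    | _ k ih =>
      obtain ⟨v, hv⟩ := h.1
      by_cases hne : (V.erase v).Nonempty
      · have h' := h.sub (Finset.erase_subset v V) hne
        have hc := Finset.card_erase_add_one hv
        have h1 := ih _ (by omega) h' rfl
        have := mface_lt hM h'.2.1 h.2.1 (h'.face hM) (h.face hM) (Finset.erase_ssubset hv)
        omega
      · rw [Finset.not_nonempty_iff_eq_empty] at hne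
        have hc := Finset.card_erase_add_one hv
        rw [hne] at hc
        simp at hc
        omega

theorem TA.lt (hM : IsMultiplex d n P x) {I J : Finset ℤ} (hI : TA d n I) (hJ : TA d n J)
    (h : I ⊂ J) : pdim (fc x (mdual d n J)) < pdim (fc x (mdual d n I)) := by
  refine mface_lt hM dual_range dual_range (hJ.face hM) (hI.face hM) ⟨?_, ?_⟩
  · intro j hj
    rw [mem_mdual] at *
    exact ⟨hj.1, fun i hi => hj.2 i (h.1 hi)⟩
  · intro hsub
    apply h.2
    rw [← hI.tb.dual_dual hM.two_le_d hM.d_le_n, ← hJ.tb.dual_dual hM.two_le_d hM.d_le_n]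
    intro j hj
    rw [mem_mdual] at *
    exact ⟨hj.1, fun i hi => hj.2 i (hsub hi)⟩

theorem TA.dim (hM : IsMultiplex d n P x) {I : Finset ℤ} (h : TA d n I) :
    I.card + pdim (fc x (mdual d n I)) = d := by
  have hd := hM.two_le_d
  have hdn := hM.d_le_n
  apply le_antisymm
  · induction hk : I.card using Nat.strong_induction_on generalizing I with
    | _ k ih =>
      obtain ⟨v, hv⟩ := h.1
      by_cases hne : (I.erase v).Nonempty
      · have h' := h.sub (Finset.erase_subset v I) hne
        have hc := Finset.card_erase_add_one hv
        have h1 := ih _ (by omega) h' rfl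
        have := h'.lt hM h (Finset.erase_ssubset hv)
        omega
      · rw [Finset.not_nonempty_iff_eq_empty] at hne
        have hI : I = {v} := by
          rw [← Finset.insert_erase hv, hne]; rfl
        have h2 := (facet_face hM (h.tb.2.1 v hv)).2
        rw [← hI] at h2
        rw [h2, ← hk, hI, Finset.card_singleton]
        omega
  · induction hk : d - 1 - I.card using Nat.strong_induction_on generalizing I with
    | _ k ih =>
      obtain ⟨W, hW, hIW, hWc⟩ := h.window hd hdn
      have hcl := Finset.card_le_card hIW
      by_cases hlt : I.card < W.card
      · obtain ⟨v, hvW, hvI⟩ := Finset.exists_mem_notMem_of_card_lt_card hlt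
        have h' := hW.sub (Finset.insert_subset hvW hIW) (Finset.insert_nonempty v I)
        have hc := Finset.card_insert_of_notMem hvI
        have h1 := ih _ (by omega) h' rfl
        have := h.lt hM h' (Finset.ssubset_insert hvI)
        omega
      · obtain ⟨a, ha, b, hb, hab⟩ := h.spread hd hdn
        have hta : TB d n {a} := by
          refine ⟨Finset.singleton_nonempty a, fun i hi => ?_, fun i hi j hj => ?_⟩
          · rw [Finset.mem_singleton] at hi
            rw [hi]; exact dual_range a ha
          · rw [Finset.mem_singleton] at hi hj
            left; omega
        have := mface_lt hM hta.2.1 (dual_range (I := I)) (hta.face hM) (h.face hM)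
          ⟨by simpa using ha, fun hs => by
            have := hs hb
            simp at this
            omega⟩
        omega

theorem mface_classify (hM : IsMultiplex d n P x) {F : Set E} (hF : IsFaceOf P F)
    (hd : pdim F < d) : (∃ V, TB d n V ∧ F = fc x V) ∨ ∃ I, TA d n I ∧ F = fc x (mdual d n I) := by
  classical
  set V := (Finset.Icc (0:ℤ) n).filter (fun j => x j ∈ F) with hV
  have hVm : ∀ j, j ∈ V ↔ (0 ≤ j ∧ j ≤ (n:ℤ)) ∧ x j ∈ F := by simp [hV]
  have hFV : F = fc x V := by
    have hF' := hF
    rw [hM.hull] at hF'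
    rw [face_hull hF', fc]
    congr 1
    ext p
    constructor
    · rintro ⟨⟨j, hj, rfl⟩, hp⟩
      exact ⟨j, (hVm j).2 ⟨hj, hp⟩, rfl⟩
    · rintro ⟨j, hj, rfl⟩
      have := (hVm j).1 hj
      exact ⟨⟨j, this.1, rfl⟩, this.2⟩
  have hVr : ∀ j ∈ V, 0 ≤ j ∧ j ≤ (n:ℤ) := fun j hj => ((hVm j).1 hj).1
  have hVne : V.Nonempty := by
    have := hF.2
    rw [hFV, fc, convexHull_nonempty_iff, Set.image_nonempty] at this
    exact this
  have hsep : ∀ j : ℤ, (0 ≤ j ∧ j ≤ (n:ℤ)) → j ∉ V → ∃ i ∈ mdual d n V, ¬ mR d n i j := by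
    intro j hj hjV
    obtain ⟨i, hi, h1, h2⟩ := face_facet_sep hM hF hj (fun h => hjV ((hVm j).2 ⟨hj, h⟩))
    refine ⟨i, mem_mdual.2 ⟨hi, fun v hv => ?_⟩, h2⟩
    have h3 := (fc_mem hM dual_range (hVr v hv)).1 (h1 ((hVm v).1 hv).2)
    exact mR_symm.1 ((mem_mdual.1 h3).2 i (Finset.mem_singleton_self i))
  by_cases hB : TB d n V
  · exact Or.inl ⟨V, hB, hFV⟩
  right
  have hex : ∃ j : ℤ, (0 ≤ j ∧ j ≤ (n:ℤ)) ∧ j ∉ V := by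
    by_contra hcon
    push Not at hcon
    have : F = P := by
      rw [hFV, hM.hull, fc]
      congr 2
      ext j
      exact ⟨fun h => hVr j h, fun h => hcon j h⟩
    rw [this, hM.dim] at hd
    exact lt_irrefl _ hd
  obtain ⟨j, hj, hjV⟩ := hex
  obtain ⟨i, hi, -⟩ := hsep j hj hjV
  refine ⟨mdual d n V, dual_TA hVr hVne hB ⟨i, hi⟩, ?_⟩
  rw [hFV]
  congr 1
  ext k
  rw [mem_mdual]
  constructor
  · intro hk
    exact ⟨hVr k hk, fun i hi => mR_symm.1 ((mem_mdual.1 hi).2 k hk)⟩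
  · rintro ⟨hk, hk'⟩
    by_contra hkV
    obtain ⟨i, hi, h⟩ := hsep k hk hkV
    exact h (hk' i hi)

noncomputable def mMap (d n : ℕ) (x : ℤ → E) (t : Tok) : Set E :=
  if t.1 then fc x (mdual d n t.2) else fc x t.2

theorem multi_count (hM : IsMultiplex d n P x) (S : Finset ℕ) (hS : ∀ s ∈ S, s < d) :
    flagNum P S = cnt (tokp d n) (tle d) S := by
  have hd := hM.two_le_d
  have hdn := hM.d_le_n
  rw [flagNum_eq_cnt]
  symm
  refine cnt_congr' (mMap d n x) (tle_anti d) (fun _ => Subset.rfl) ?_ ?_ ?_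
  · rintro ⟨b, X⟩ s hs ⟨h0, ⟨rfl, h1, h2⟩ | ⟨rfl, h1, h2⟩⟩
    · have h : TB d n X := ⟨h0, h2⟩
      have := h.dim hM
      simp only [mMap, Bool.false_eq_true, if_false]
      simp only at h1
      exact ⟨h.face hM, by omega⟩
    · have h : TA d n X := ⟨h0, h2⟩
      have := h.dim hM
      simp only [mMap, if_true]
      simp only at h1
      exact ⟨h.face hM, by omega⟩
  · rintro F s hs ⟨hF, rfl⟩
    rcases mface_classify hM hF (hS _ hs) with ⟨V, hV, rfl⟩ | ⟨V, hV, rfl⟩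
    · refine ⟨(false, V), ⟨hV.1, Or.inl ⟨rfl, ?_, hV.2⟩⟩, by simp [mMap]⟩
      have := hV.dim hM
      simp only; omega
    · refine ⟨(true, V), ⟨hV.1, Or.inr ⟨rfl, ?_, hV.2⟩⟩, by simp [mMap]⟩
      exact hV.dim hM
  · rintro ⟨b, X⟩ ⟨b', Y⟩ s hs t ht - ⟨h0, ⟨rfl, h1, h2⟩ | ⟨rfl, h1, h2⟩⟩
      ⟨h0', ⟨rfl, h1', h2'⟩ | ⟨rfl, h1', h2'⟩⟩ <;>
      simp only [mMap, Bool.false_eq_true, if_false, if_true]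
    · rw [fc_sub hM h2.1 h2'.1]
      simp [tle]
    · rw [fc_sub hM h2.1 dual_range]
      simp only [tle, reduceCtorEq, false_and, and_false, true_and, false_or]
      constructor
      · intro h i hi
        rw [mem_mdual]
        refine ⟨h2.1 i hi, fun j hj => ?_⟩
        have := h i hi j hj
        unfold mR; omega
      · intro h i hi j hj
        have h4 := (mem_mdual.1 (h hi)).2 j hj
        have := h2'.1 j hj
        unfold mR at h4; omega
    · rw [fc_sub hM dual_range h2'.1]
      simp only [tle, reduceCtorEq, false_and, and_false, false_or, false_iff]
      intro h
      have hA : TA d n X := ⟨h0, h2⟩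
      obtain ⟨a, ha, b, hb, hab⟩ := hA.spread hd hdn
      have := h2'.2 a (h ha) b (h hb)
      omega
    · rw [fc_sub hM dual_range dual_range]
      simp only [tle, reduceCtorEq, false_and, false_or, true_and, or_false]
      have hA : TA d n X := ⟨h0, h2⟩
      have hA' : TA d n Y := ⟨h0', h2'⟩
      constructor
      · intro h j hj
        rw [mem_mdual] at *
        exact ⟨hj.1, fun i hi => hj.2 i (h hi)⟩
      · intro h
        rw [← hA.tb.dual_dual hd hdn, ← hA'.tb.dual_dual hd hdn]
        intro j hj
        rw [mem_mdual] at *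
        exact ⟨hj.1, fun i hi => hj.2 i (h hi)⟩

end multi


section pyr
variable {E : Type*} [NormedAddCommGroup E] [NormedSpace ℝ E]

/-- a face or the empty set -/
def EF (P F : Set E) : Prop := F = ∅ ∨ IsFaceOf P F

open Classical in
noncomputable def erk (F : Set E) : ℕ := if F = ∅ then 0 else pdim F + 1

theorem EF.convex {X F : Set E} (h : EF (convexHull ℝ X) F) : Convex ℝ F := by
  rcases h with rfl | h
  · exact convex_empty
  · rw [face_hull h]; exact convex_convexHull ℝ _

theorem EF.subset {P F : Set E} (h : EF P F) : F ⊆ P := by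
  rcases h with rfl | h
  · exact Set.empty_subset _
  · exact face_subset h

theorem apex_functional {X : Set E} (hX : X.Finite) (hne : X.Nonempty) {a : E}
    (ha : a ∉ affineSpan ℝ X) :
    ∃ (g : E →L[ℝ] ℝ) (c : ℝ), (∀ x ∈ X, g x = c) ∧ g a < c := by
  have : Finite X := hX
  obtain ⟨r, hr⟩ := hne
  set D := (affineSpan ℝ X).direction with hD
  have hfd : FiniteDimensional ℝ D := finiteDimensional_direction_affineSpan_of_finite ℝ hX
  have haD : a - r ∉ D := by
    intro h
    apply ha
    have := AffineSubspace.vadd_mem_of_mem_direction h (subset_affineSpan ℝ X hr)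
    simpa using this
  obtain ⟨φ, hφ1, hφ2⟩ := Submodule.exists_le_ker_of_notMem haD
  obtain ⟨g, hg⟩ := ext_cont (D ⊔ Submodule.span ℝ {a - r}) φ
  have h1 : ∀ x ∈ X, g x = g r := by
    intro x hx
    have hxD : x - r ∈ D := AffineSubspace.vsub_mem_direction (subset_affineSpan ℝ _ hx)
      (subset_affineSpan ℝ _ hr)
    have := hg _ (Submodule.mem_sup_left hxD)
    rw [show φ (x - r) = 0 from hφ2 hxD, map_sub] at this
    linarith
  have h2 : g (a - r) ≠ 0 := by
    rw [hg _ (Submodule.mem_sup_right (Submodule.mem_span_singleton_self _))]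
    exact hφ1
  rw [map_sub] at h2
  rcases lt_trichotomy (g a) (g r) with h | h | h
  · exact ⟨g, g r, h1, h⟩
  · exact absurd (by linarith) h2
  · refine ⟨-g, -g r, fun x hx => ?_, ?_⟩
    · rw [neg_apply, h1 x hx]
    · rw [neg_apply]; linarith

theorem hull_insert_hull (a : E) (W : Set E) :
    convexHull ℝ (insert a (convexHull ℝ W)) = convexHull ℝ (insert a W) := by
  apply Set.Subset.antisymm
  · refine convexHull_min ?_ (convex_convexHull ℝ _)
    rw [Set.insert_subset_iff]
    exact ⟨subset_convexHull ℝ _ (Set.mem_insert _ _), convexHull_mono (Set.subset_insert _ _)⟩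
  · exact convexHull_mono (Set.insert_subset_insert (subset_convexHull ℝ _))

variable {X : Set E} {a : E}

theorem slice_apex (hX : X.Finite) (hne : X.Nonempty) (ha : a ∉ affineSpan ℝ X) {F : Set E}
    (hF : F ⊆ convexHull ℝ X) (hc : Convex ℝ F) :
    convexHull ℝ (insert a F) ∩ convexHull ℝ X = F := by
  obtain ⟨g, c, h1, h2⟩ := apex_functional hX hne ha
  have hR : ∀ p ∈ convexHull ℝ X, g p = c := fun p hp =>
    convexHull_min (t := {p | g p = c}) h1 (convex_hyperplane g.toLinearMap.isLinear c) hp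
  have hs := hull_slice (insert a F) g c (by
    rintro x (rfl | hx)
    · exact h2.le
    · exact (hR x (hF hx)).le)
  have hW : {x ∈ insert a F | g x = c} = F := by
    ext x
    constructor
    · rintro ⟨rfl | hx, hxc⟩
      · exact absurd hxc h2.ne
      · exact hx
    · intro hx
      exact ⟨Or.inr hx, hR x (hF hx)⟩
  rw [hW, hc.convexHull_eq] at hs
  apply Set.Subset.antisymm
  · rintro p ⟨hp1, hp2⟩
    rw [← hs]
    exact ⟨hp1, hR p hp2⟩
  · intro p hp
    exact ⟨subset_convexHull ℝ _ (Or.inr hp), hF hp⟩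

theorem apex_notMem (ha : a ∉ affineSpan ℝ X) : a ∉ convexHull ℝ X :=
  fun h => ha (convexHull_subset_affineSpan X h)

theorem pyr_face_base (hX : X.Finite) (hne : X.Nonempty) (ha : a ∉ affineSpan ℝ X) {F : Set E}
    (hF : EF (convexHull ℝ X) F) : EF (convexHull ℝ (insert a X)) F := by
  rcases hF with rfl | hF
  · exact Or.inl rfl
  right
  obtain ⟨g, c0, g1, g2⟩ := apex_functional hX hne ha
  obtain ⟨l, c, h1, ⟨w, hw, hwc⟩, h2, -, -⟩ := face_dest hF
  have hpos : 0 < c0 - g a := by linarith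
  set t := (|l a - c| + 1) / (c0 - g a) with ht
  have htm : t * (c0 - g a) = |l a - c| + 1 := div_mul_cancel₀ _ hpos.ne'
  have hval : ∀ x, (l + t • g) x = l x + t * g x := fun x => by simp
  have hlt : (l + t • g) a < c + t * c0 := by
    rw [hval]
    have := le_abs_self (l a - c)
    linarith
  have := face_mk (insert a X) (l + t • g) (c + t * c0) (by
    rintro x (rfl | hx)
    · exact hlt.le
    · rw [hval, g1 x hx]; linarith [h1 x hx]) ⟨w, Or.inr hw, by rw [hval, g1 w hw, hwc]⟩
  rw [h2]
  convert this using 2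
  ext x
  constructor
  · rintro ⟨hx, hxc⟩
    exact ⟨Or.inr hx, by rw [hval, g1 x hx, hxc]⟩
  · rintro ⟨rfl | hx, hxc⟩
    · exact absurd hxc hlt.ne
    · rw [hval, g1 x hx] at hxc
      exact ⟨hx, by linarith⟩

theorem pyr_face_apex (hX : X.Finite) (hne : X.Nonempty) (ha : a ∉ affineSpan ℝ X) {F : Set E}
    (hF : EF (convexHull ℝ X) F) :
    IsFaceOf (convexHull ℝ (insert a X)) (convexHull ℝ (insert a F)) := by
  obtain ⟨g, c0, g1, g2⟩ := apex_functional hX hne ha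
  rcases hF with rfl | hF
  · have := face_mk (insert a X) (-g) (-g a) (by
      rintro x (rfl | hx)
      · exact le_rfl
      · rw [neg_apply, g1 x hx]; linarith) ⟨a, Or.inl rfl, rfl⟩
    convert this using 2
    ext x
    constructor
    · rintro (rfl | hx)
      · exact ⟨Or.inl rfl, rfl⟩
      · exact absurd hx (Set.notMem_empty x)
    · rintro ⟨rfl | hx, hxc⟩
      · exact Or.inl rfl
      · rw [neg_apply, g1 x hx] at hxc
        linarith
  obtain ⟨l, c, h1, ⟨w, hw, hwc⟩, h2, -, -⟩ := face_dest hF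
  have hpos : 0 < c0 - g a := by linarith
  set t := (l a - c) / (c0 - g a) with ht
  have htm : t * (c0 - g a) = l a - c := div_mul_cancel₀ _ hpos.ne'
  have hval : ∀ x, (l + t • g) x = l x + t * g x := fun x => by simp
  have hlt : (l + t • g) a = c + t * c0 := by
    rw [hval]
    linarith
  have := face_mk (insert a X) (l + t • g) (c + t * c0) (by
    rintro x (rfl | hx)
    · exact hlt.le
    · rw [hval, g1 x hx]; linarith [h1 x hx]) ⟨w, Or.inr hw, by rw [hval, g1 w hw, hwc]⟩
  rw [h2, hull_insert_hull]
  convert this using 2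
  ext x
  constructor
  · rintro (rfl | ⟨hx, hxc⟩)
    · exact ⟨Or.inl rfl, hlt⟩
    · exact ⟨Or.inr hx, by rw [hval, g1 x hx, hxc]⟩
  · rintro ⟨rfl | hx, hxc⟩
    · exact Or.inl rfl
    · rw [hval, g1 x hx] at hxc
      exact Or.inr ⟨hx, by linarith⟩

theorem pyr_classify {G : Set E}
    (hG : EF (convexHull ℝ (insert a X)) G) :
    ∃ F, EF (convexHull ℝ X) F ∧ (G = F ∨ G = convexHull ℝ (insert a F)) := by
  rcases hG with rfl | hG
  · exact ⟨∅, Or.inl rfl, Or.inl rfl⟩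
  obtain ⟨l, c, h1, ⟨w, hw, hwc⟩, h2, -, -⟩ := face_dest hG
  have h1' : ∀ x ∈ X, l x ≤ c := fun x hx => h1 x (Or.inr hx)
  by_cases hWn : ∃ x ∈ X, l x = c
  · refine ⟨convexHull ℝ {x ∈ X | l x = c}, Or.inr (face_mk X l c h1' hWn), ?_⟩
    by_cases hac : l a = c
    · right
      rw [h2, hull_insert_hull]
      congr 1
      ext x
      constructor
      · rintro ⟨rfl | hx, hxc⟩
        · exact Or.inl rfl
        · exact Or.inr ⟨hx, hxc⟩
      · rintro (rfl | ⟨hx, hxc⟩)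
        · exact ⟨Or.inl rfl, hac⟩
        · exact ⟨Or.inr hx, hxc⟩
    · left
      rw [h2]
      congr 1
      ext x
      constructor
      · rintro ⟨rfl | hx, hxc⟩
        · exact absurd hxc hac
        · exact ⟨hx, hxc⟩
      · rintro ⟨hx, hxc⟩
        exact ⟨Or.inr hx, hxc⟩
  · refine ⟨∅, Or.inl rfl, Or.inr ?_⟩
    rw [h2]
    congr 1
    ext x
    constructor
    · rintro ⟨rfl | hx, hxc⟩
      · exact Or.inl rfl
      · exact absurd ⟨x, hx, hxc⟩ hWn
    · rintro (rfl | hx)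
      · refine ⟨Or.inl rfl, ?_⟩
        rcases hw with rfl | hw
        · exact hwc
        · exact absurd ⟨w, hw, hwc⟩ hWn
      · exact absurd hx (Set.notMem_empty x)

theorem pyr_rk (hX : X.Finite) (hne : X.Nonempty) (ha : a ∉ affineSpan ℝ X) {F : Set E}
    (hF : EF (convexHull ℝ X) F) : erk (convexHull ℝ (insert a F)) = erk F + 1 := by
  have hface := pyr_face_apex hX hne ha hF
  have hne' : convexHull ℝ (insert a F) ≠ ∅ := hface.2.ne_empty
  rw [erk, if_neg hne', erk]
  by_cases hF0 : F = ∅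
  · subst hF0
    rw [if_pos rfl]
    simp [pdim, direction_affineSpan]
  rw [if_neg hF0]
  have hF' : IsFaceOf (convexHull ℝ (insert a X)) F :=
    (pyr_face_base hX hne ha hF).resolve_left hF0
  have hlt : pdim F < pdim (convexHull ℝ (insert a F)) := by
    refine face_pdim_lt (hX.insert a) hF' hface ⟨?_, ?_⟩
    · exact (Set.subset_insert a F).trans (subset_convexHull ℝ _)
    · intro h
      exact apex_notMem ha (hF.subset (h (subset_convexHull ℝ _ (Set.mem_insert a F))))
  have hle : pdim (convexHull ℝ (insert a F)) ≤ pdim F + 1 := by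
    have : Finite X := hX
    rw [pdim_convexHull]
    obtain ⟨f, hf⟩ := Set.nonempty_iff_ne_empty.2 hF0
    have hFD : (affineSpan ℝ F).direction ≤ (affineSpan ℝ (convexHull ℝ X)).direction :=
      AffineSubspace.direction_le (affineSpan_mono ℝ hF.subset)
    have := Submodule.finiteDimensional_of_le hFD
    unfold pdim
    rw [← affineSpan_insert_affineSpan,
      AffineSubspace.direction_affineSpan_insert (subset_affineSpan ℝ F hf)]
    have e1 := Submodule.finrank_add_le_finrank_add_finrank
      (Submodule.span ℝ {a -ᵥ f}) (affineSpan ℝ F).direction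
    have e2 := finrank_span_le_card (R := ℝ) ({a -ᵥ f} : Set E)
    rw [Set.toFinset_singleton, Finset.card_singleton] at e2
    omega
  omega

/-- coding of the face lattice -/
structure Coding {β γ : Type*} (inc : β → γ → Prop) (M : Finset ℤ) (Q : Set E)
    (Φ : Finset ℤ × PF β γ → Set E) : Prop where
  ef : ∀ x, x.1 ⊆ M → EF Q (Φ x)
  rk : ∀ x, x.1 ⊆ M → erk (Φ x) = x.1.card + x.2.rk
  surj : ∀ F, EF Q F → ∃ x, x.1 ⊆ M ∧ Φ x = F
  le : ∀ x y, x.1 ⊆ M → y.1 ⊆ M → (plle inc x y ↔ Φ x ⊆ Φ y)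

theorem Coding.count {β γ : Type*} {inc : β → γ → Prop} {M : Finset ℤ} {Q : Set E}
    {Φ : Finset ℤ × PF β γ → Set E} (h : Coding inc M Q Φ) (S : Finset ℕ) :
    flagNum Q S = cnt (plp M) (plle inc) S := by
  rw [flagNum_eq_cnt]
  symm
  refine cnt_congr' Φ (plle_anti inc) (fun _ => Subset.rfl) ?_ ?_ ?_
  · rintro x s - ⟨h1, h2⟩
    have hr := h.rk x h1
    rw [h2, erk] at hr
    by_cases h0 : Φ x = ∅
    · rw [if_pos h0] at hr; omega
    · rw [if_neg h0] at hr
      exact ⟨(h.ef x h1).resolve_left h0, by omega⟩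
  · rintro F s - ⟨h1, h2⟩
    obtain ⟨x, hx, rfl⟩ := h.surj F (Or.inr h1)
    refine ⟨x, ⟨hx, ?_⟩, rfl⟩
    rw [← h.rk x hx, erk, if_neg h1.2.ne_empty, h2]
  · rintro x y s - t - - ⟨h1, -⟩ ⟨h1', -⟩
    exact h.le x y h1 h1'

theorem Coding.pyr {β γ : Type*} {inc : β → γ → Prop} {M : Finset ℤ}
    {Φ : Finset ℤ × PF β γ → Set E} (h : Coding inc M (convexHull ℝ X) Φ) (hX : X.Finite)
    (hne : X.Nonempty) (ha : a ∉ affineSpan ℝ X) (m : ℤ) (hm : m ∉ M) :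
    ∃ Ψ : Finset ℤ × PF β γ → Set E, Coding inc (insert m M) (convexHull ℝ (insert a X)) Ψ := by
  classical
  refine ⟨fun x => if m ∈ x.1 then convexHull ℝ (insert a (Φ (x.1.erase m, x.2))) else Φ x,
    ?_, ?_, ?_, ?_⟩
  · intro x hx
    by_cases hmx : m ∈ x.1
    · simp only [if_pos hmx]
      exact Or.inr (pyr_face_apex hX hne ha (h.ef _ (Finset.subset_insert_iff.1 hx)))
    · simp only [if_neg hmx]
      exact pyr_face_base hX hne ha (h.ef _ ((Finset.subset_insert_iff_of_notMem hmx).1 hx))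
  · intro x hx
    by_cases hmx : m ∈ x.1
    · simp only [if_pos hmx]
      rw [pyr_rk hX hne ha (h.ef _ (Finset.subset_insert_iff.1 hx)),
        h.rk _ (Finset.subset_insert_iff.1 hx)]
      have := Finset.card_erase_add_one hmx
      simp only
      omega
    · simp only [if_neg hmx]
      exact h.rk _ ((Finset.subset_insert_iff_of_notMem hmx).1 hx)
  · intro G hG
    obtain ⟨F, hF, hGF⟩ := pyr_classify hG
    obtain ⟨⟨J, g⟩, hx, rfl⟩ := h.surj F hF
    have hmJ : m ∉ J := fun hh => hm (hx hh)
    rcases hGF with rfl | rfl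
    · refine ⟨(J, g), hx.trans (Finset.subset_insert m M), ?_⟩
      simp only [if_neg hmJ]
    · refine ⟨(insert m J, g), Finset.insert_subset_insert m hx, ?_⟩
      simp only [if_pos (Finset.mem_insert_self m J), Finset.erase_insert hmJ]
  · rintro ⟨J, g⟩ ⟨J', g'⟩ hx hy
    simp only at hx hy
    have hx' := Finset.subset_insert_iff.1 hx
    have hy' := Finset.subset_insert_iff.1 hy
    have hA := h.ef (J.erase m, g) hx'
    have hB := h.ef (J'.erase m, g') hy'
    have hle := h.le (J.erase m, g) (J'.erase m, g') hx' hy'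
    have hsl := slice_apex hX hne ha hB.subset hB.convex
    have haP := apex_notMem ha
    by_cases h1 : m ∈ J <;> by_cases h2 : m ∈ J' <;> simp only [h1, h2, if_true, if_false]
    · have e1 : plle inc (J, g) (J', g') ↔ plle inc (J.erase m, g) (J'.erase m, g') := by
        unfold plle
        refine and_congr_left fun _ => ?_
        rw [Finset.subset_erase]
        constructor
        · intro hh; exact ⟨(Finset.erase_subset _ _).trans hh, Finset.notMem_erase m J⟩
        · rintro ⟨hh, -⟩ i hi
          by_cases him : i = m
          · exact him ▸ h2
          · exact hh (Finset.mem_erase.2 ⟨him, hi⟩)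
      rw [e1, hle]
      constructor
      · intro hh
        exact convexHull_mono (Set.insert_subset_insert hh)
      · intro hh
        rw [← hsl]
        exact Set.subset_inter ((Set.subset_insert a _).trans
          ((subset_convexHull ℝ _).trans hh)) hA.subset
    · rw [Finset.erase_eq_of_notMem h2] at hB
      constructor
      · rintro ⟨hh, -⟩
        exact absurd (hh h1) h2
      · intro hh
        exact absurd (hB.subset (hh (subset_convexHull ℝ _ (Set.mem_insert a _)))) haP
    · rw [Finset.erase_eq_of_notMem h1] at hA hle
      have e1 : plle inc (J, g) (J', g') ↔ plle inc (J, g) (J'.erase m, g') := by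
        unfold plle
        refine and_congr_left fun _ => ?_
        rw [Finset.subset_erase]
        exact ⟨fun hh => ⟨hh, h1⟩, fun hh => hh.1⟩
      rw [e1, hle]
      constructor
      · intro hh
        exact hh.trans ((Set.subset_insert a _).trans (subset_convexHull ℝ _))
      · intro hh
        rw [← hsl]
        exact Set.subset_inter hh hA.subset
    · rw [Finset.erase_eq_of_notMem h1, Finset.erase_eq_of_notMem h2] at hle
      exact hle

theorem pyr_coding {β γ : Type*} {inc : β → γ → Prop} {X : Set E} (hX : X.Finite)
    (hne : X.Nonempty) {Φ : Finset ℤ × PF β γ → Set E}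
    (h : Coding inc ∅ (convexHull ℝ X) Φ) (k : ℕ) (Q : Set E)
    (hQ : IsKFoldPyramid k Q (convexHull ℝ X)) :
    ∃ Y : Set E, Y.Finite ∧ Y.Nonempty ∧ Q = convexHull ℝ Y ∧
      ∃ Ψ : Finset ℤ × PF β γ → Set E, Coding inc (Finset.Icc (2:ℤ) (k + 1)) Q Ψ := by
  induction k generalizing Q with
  | zero =>
    have hQ' : Q = convexHull ℝ X := hQ
    subst hQ'
    exact ⟨X, hX, hne, rfl, Φ, by simpa using h⟩
  | succ k ih =>
    obtain ⟨R, a, hR, ha, rfl⟩ := hQ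
    obtain ⟨Y, hY, hYne, rfl, Ψ, hΨ⟩ := ih R hR
    rw [affineSpan_convexHull] at ha
    rw [hull_insert_hull]
    refine ⟨insert a Y, hY.insert a, Set.insert_nonempty a Y, rfl, ?_⟩
    have := hΨ.pyr hY hYne ha (k + 2) (by simp)
    convert this using 3
    ext i
    simp
    omega

end pyr


section poly
variable {E : Type*} [NormedAddCommGroup E] [NormedSpace ℝ E]

theorem pdim_singleton (p : E) : pdim ({p} : Set E) = 0 := by
  simp [pdim, direction_affineSpan]

theorem face_vertex {X : Set E} (hX : X.Finite) {p : E}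
    (hp : p ∈ Set.extremePoints ℝ (convexHull ℝ X)) (hpX : p ∈ X) :
    IsFaceOf (convexHull ℝ X) {p} := by
  have hnot : p ∉ convexHull ℝ (X \ {p}) := by
    intro h
    have h1 := inter_extremePoints_subset_extremePoints_of_subset (𝕜 := ℝ)
      (convexHull_mono (𝕜 := ℝ) (Set.sdiff_subset (s := X) (t := {p}))) ⟨h, hp⟩
    exact (extremePoints_convexHull_subset h1).2 rfl
  have hfin : (X \ {p}).Finite := hX.subset Set.sdiff_subset
  obtain ⟨l, u, h1, h2⟩ := geometric_hahn_banach_closed_point (convex_convexHull ℝ (X \ {p}))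
    (hfin.isClosed_convexHull ℝ) hnot
  have hlt : ∀ x ∈ X, x ≠ p → l x < l p := fun x hx hxp =>
    (h1 x (subset_convexHull ℝ _ ⟨hx, hxp⟩)).trans h2
  have := face_mk X l (l p) (fun x hx => by
    by_cases hxp : x = p
    · rw [hxp]
    · exact (hlt x hx hxp).le) ⟨p, hpX, rfl⟩
  have e : {x ∈ X | l x = l p} = {p} := by
    ext x
    constructor
    · rintro ⟨hx, hxl⟩
      by_contra hxp
      exact (hlt x hx hxp).ne hxl
    · rintro rfl
      exact ⟨hpX, rfl⟩
  rwa [e, convexHull_singleton] at this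


theorem edge_two
    {v : Finset E} (hv : Set.extremePoints ℝ (convexHull ℝ (v : Set E)) = (v : Set E)) {e : Set E} (he : IsFaceOf (convexHull ℝ (v : Set E)) e) (h1 : pdim e = 1) {p : E}
    (hp : p ∈ v) (hpe : p ∈ e) :
    ∃ q ∈ v, q ≠ p ∧ q ∈ e ∧ (∀ r ∈ v, r ∈ e → r = p ∨ r = q) ∧ e = convexHull ℝ {p, q} := by
  have heq := face_hull he
  have hex : ∃ q ∈ v, q ≠ p ∧ q ∈ e := by
    by_contra hcon
    push Not at hcon
    have : (v : Set E) ∩ e = {p} := by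
      ext r
      constructor
      · rintro ⟨hr, hre⟩
        by_contra hrp
        exact hcon r hr hrp hre
      · rintro rfl
        exact ⟨hp, hpe⟩
    rw [this, convexHull_singleton] at heq
    rw [heq, pdim_singleton] at h1
    omega
  obtain ⟨q, hq, hqp, hqe⟩ := hex
  have hcol : Collinear ℝ ((v : Set E) ∩ e) := by
    have hfin : ((v : Set E) ∩ e).Finite := v.finite_toSet.subset Set.inter_subset_left
    have := finiteDimensional_vectorSpan_of_finite ℝ hfin
    rw [collinear_iff_finrank_le_one, ← direction_affineSpan]
    change pdim ((v : Set E) ∩ e) ≤ 1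
    rw [← pdim_convexHull, ← heq, h1]
  have key : ∀ a b c : E, a ∈ v → b ∈ v → c ∈ v → a ≠ b → c ≠ b → ¬ Wbtw ℝ a b c := by
    intro a b c ha hb hc hab hcb hw
    have hb' : b ∈ Set.extremePoints ℝ (convexHull ℝ (v : Set E)) := by rw [hv]; exact hb
    have hs : b ∈ openSegment ℝ a c := mem_openSegment_of_ne_left_right hab hcb
      (mem_segment_iff_wbtw.2 hw)
    exact hab (hb'.2 (subset_convexHull ℝ _ ha) (subset_convexHull ℝ _ hc) hs)
  have hall : ∀ r ∈ v, r ∈ e → r = p ∨ r = q := by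
    intro r hr hre
    by_contra hcon
    push Not at hcon
    have hc3 : Collinear ℝ {p, q, r} := hcol.subset (by
      rintro z (rfl | rfl | rfl)
      · exact ⟨hp, hpe⟩
      · exact ⟨hq, hqe⟩
      · exact ⟨hr, hre⟩)
    rcases hc3.wbtw_or_wbtw_or_wbtw with h | h | h
    · exact key _ _ _ hp hq hr hqp.symm hcon.2 h
    · exact key _ _ _ hq hr hp hcon.2.symm hcon.1.symm h
    · exact key _ _ _ hr hp hq hcon.1 hqp h
  refine ⟨q, hq, hqp, hqe, hall, ?_⟩
  have : (v : Set E) ∩ e = {p, q} := by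
    ext r
    constructor
    · rintro ⟨hr, hre⟩
      exact hall r hr hre
    · rintro (rfl | rfl)
      · exact ⟨hp, hpe⟩
      · exact ⟨hq, hqe⟩
  rw [← this]
  exact heq

theorem no_three
    {v : Finset E} (hv : Set.extremePoints ℝ (convexHull ℝ (v : Set E)) = (v : Set E)) (h2 : pdim (convexHull ℝ (v : Set E)) = 2) {p : E} (hp : p ∈ v)
    (e : Fin 3 → Set E) (he : ∀ i, IsFaceOf (convexHull ℝ (v : Set E)) (e i))
    (h1 : ∀ i, pdim (e i) = 1) (hpe : ∀ i, p ∈ e i) (hne : Function.Injective e) : False := by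
  choose w hw hwp hwe hwall heq using fun i => edge_two hv (he i) (h1 i) hp (hpe i)
  have hnot : ∀ i j, i ≠ j → w i ∉ e j := by
    intro i j hij hmem
    rcases hwall j (w i) (hw i) hmem with h | h
    · exact hwp i h
    · apply hij
      apply hne
      rw [heq i, heq j, h]
  choose l c hl hlw hF1 hF2 hF3 using fun i => face_dest (he i)
  have hval : ∀ i z, z ∈ e i → l i z = c i := by
    intro i z hz
    rw [hF2 i] at hz
    exact hz.2
  have hu0 : ∀ i, l i (w i - p) = 0 := by
    intro i
    rw [map_sub, hval i _ (hwe i), hval i _ (hpe i), sub_self]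
  have hu1 : ∀ i j, j ≠ i → l i (w j - p) < 0 := by
    intro i j hij
    rw [map_sub, hval i _ (hpe i)]
    have := hF3 i (w j) (subset_convexHull ℝ _ (hw j)) (hnot j i hij)
    linarith
  have hdep : ¬ LinearIndependent ℝ (fun i => w i - p) := by
    intro hli
    have hfd : FiniteDimensional ℝ (affineSpan ℝ (convexHull ℝ (v : Set E))).direction :=
      fd_dir (v : Set E)
    have hmem : ∀ i, w i - p ∈ (affineSpan ℝ (convexHull ℝ (v : Set E))).direction := fun i =>
      AffineSubspace.vsub_mem_direction
        (subset_affineSpan ℝ _ (subset_convexHull ℝ _ (hw i)))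
        (subset_affineSpan ℝ _ (subset_convexHull ℝ _ hp))
    have hli' : LinearIndependent ℝ (fun i => (⟨w i - p, hmem i⟩ :
        (affineSpan ℝ (convexHull ℝ (v : Set E))).direction)) :=
      LinearIndependent.of_comp (Submodule.subtype _) hli
    have := hli'.fintype_card_le_finrank
    change _ ≤ pdim _ at this
    rw [h2] at this
    simp at this
  rw [Fintype.linearIndependent_iff] at hdep
  push Not at hdep
  obtain ⟨a, hsum, i0, hi0⟩ := hdep
  rw [Fin.sum_univ_three] at hsum
  have E0 := congrArg (l 0) hsum
  have E1 := congrArg (l 1) hsum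
  have E2 := congrArg (l 2) hsum
  simp only [map_add, map_smul, smul_eq_mul, map_zero, hu0] at E0 E1 E2
  have A01 := hu1 0 1 (by decide)
  have A02 := hu1 0 2 (by decide)
  have A10 := hu1 1 0 (by decide)
  have A12 := hu1 1 2 (by decide)
  have A20 := hu1 2 0 (by decide)
  have A21 := hu1 2 1 (by decide)
  have sgn : ∀ x y s t : ℝ, s < 0 → t < 0 → x * s + y * t = 0 →
      (x = 0 ∧ y = 0) ∨ (0 < x ∧ y < 0) ∨ (x < 0 ∧ 0 < y) := by
    intro x y s t hs ht hxy
    rcases lt_trichotomy x 0 with h | h | h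
    · exact Or.inr (Or.inr ⟨h, by nlinarith⟩)
    · subst h
      left
      refine ⟨rfl, ?_⟩
      rw [zero_mul, zero_add] at hxy
      exact (mul_eq_zero.1 hxy).resolve_right ht.ne
    · exact Or.inr (Or.inl ⟨h, by nlinarith⟩)
  have S0 := sgn (a 1) (a 2) _ _ A01 A02 (by linarith)
  have S1 := sgn (a 0) (a 2) _ _ A10 A12 (by linarith)
  have S2 := sgn (a 0) (a 1) _ _ A20 A21 (by linarith)
  have hz : a 0 = 0 ∧ a 1 = 0 ∧ a 2 = 0 := by
    rcases S0 with S0 | S0 | S0 <;> rcases S1 with S1 | S1 | S1 <;>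
      rcases S2 with S2 | S2 | S2 <;> refine ⟨?_, ?_, ?_⟩ <;> linarith
  apply hi0
  fin_cases i0
  · exact hz.1
  · exact hz.2.1
  · exact hz.2.2

end poly

/-- the edges of a set -/
abbrev Edge {E : Type*} [NormedAddCommGroup E] [NormedSpace ℝ E] (B : Set E) : Type _ :=
  {F : Set E // IsFaceOf B F ∧ pdim F = 1}

section poly2
variable {E : Type*} [NormedAddCommGroup E] [NormedSpace ℝ E]

/-- incidence -/
def pinc (v : Finset E) (a : v) (e : Edge (convexHull ℝ (v : Set E))) : Prop := a.1 ∈ e.1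

/-- coding of the polygon -/
def pcode (v : Finset E) : Finset ℤ × PF v (Edge (convexHull ℝ (v : Set E))) → Set E
  | (_, PF.bot) => ∅
  | (_, PF.vert a) => {a.1}
  | (_, PF.edge e) => e.1
  | (_, PF.top) => convexHull ℝ (v : Set E)

theorem edge_finite (v : Finset E) : Finite (Edge (convexHull ℝ (v : Set E))) := by
  have : Finite (Set.powerset (v : Set E)) := v.finite_toSet.finite_subsets
  refine Finite.of_injective (β := Set.powerset (v : Set E))
    (fun e => ⟨(v : Set E) ∩ e.1, Set.inter_subset_left⟩) ?_
  intro e f h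
  have h' : (v : Set E) ∩ e.1 = (v : Set E) ∩ f.1 := congrArg Subtype.val h
  apply Subtype.ext
  rw [face_hull e.2.1, face_hull f.2.1, h']


theorem card_edge
    {v : Finset E} (hv : Set.extremePoints ℝ (convexHull ℝ (v : Set E)) = (v : Set E)) (e : Edge (convexHull ℝ (v : Set E))) :
    Nat.card {a : v // pinc v a e} = 2 := by
  have hne : ((v : Set E) ∩ e.1).Nonempty := by
    rw [← convexHull_nonempty_iff (𝕜 := ℝ), ← face_hull e.2.1]
    exact e.2.1.2
  obtain ⟨p, hp, hpe⟩ := hne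
  obtain ⟨q, hq, hqp, hqe, hall, -⟩ := edge_two hv e.2.1 e.2.2 hp hpe
  rw [Nat.card_eq_two_iff]
  refine ⟨⟨⟨p, hp⟩, hpe⟩, ⟨⟨q, hq⟩, hqe⟩, ?_, ?_⟩
  · intro h
    exact hqp (congrArg (fun z => z.1.1) h).symm
  · ext ⟨⟨r, hr⟩, hre⟩
    simp only [Set.mem_insert_iff, Set.mem_singleton_iff, Set.mem_univ, iff_true]
    exact (hall r hr hre).imp (fun h => Subtype.ext (Subtype.ext h))
      (fun h => Subtype.ext (Subtype.ext h))

theorem card_vert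
    {v : Finset E} (hv : Set.extremePoints ℝ (convexHull ℝ (v : Set E)) = (v : Set E))
    (h2 : pdim (convexHull ℝ (v : Set E)) = 2) (a : v) :
    Nat.card {e : Edge (convexHull ℝ (v : Set E)) // pinc v a e} = 2 := by
  obtain ⟨p, hp⟩ := a
  have hpf : IsFaceOf (convexHull ℝ (v : Set E)) {p} :=
    face_vertex v.finite_toSet (by rw [hv]; exact hp) hp
  have hex : ∃ q ∈ v, q ≠ p := by
    by_contra hcon
    push Not at hcon
    have : (v : Set E) = {p} := by
      ext r
      constructor
      · intro hr; exact hcon r hr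
      · rintro rfl; exact hp
    rw [this, convexHull_singleton, pdim_singleton] at h2
    omega
  obtain ⟨q, hq, hqp⟩ := hex
  obtain ⟨e, he, hpe, -, hde⟩ := face_facet v.finite_toSet hpf q hq hqp
  have hde1 : pdim e = 1 := by omega
  rw [Set.singleton_subset_iff] at hpe
  obtain ⟨w, hw, hwp, hwe, -, -⟩ := edge_two hv he hde1 hp hpe
  obtain ⟨f, hf, hpf', hwf, hdf⟩ := face_facet v.finite_toSet hpf w hw hwp
  have hdf1 : pdim f = 1 := by omega
  rw [Set.singleton_subset_iff] at hpf'
  have hef : e ≠ f := by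
    rintro rfl
    exact hwf hwe
  rw [Nat.card_eq_two_iff]
  refine ⟨⟨⟨e, he, hde1⟩, hpe⟩, ⟨⟨f, hf, hdf1⟩, hpf'⟩, ?_, ?_⟩
  · intro h
    exact hef (congrArg (fun z => z.1.1) h)
  · ext ⟨⟨g, hg, hdg⟩, hpg⟩
    simp only [Set.mem_insert_iff, Set.mem_singleton_iff, Set.mem_univ, iff_true]
    by_contra hcon
    push Not at hcon
    have hpg' : p ∈ g := hpg
    have hge : g ≠ e := fun h => hcon.1 (Subtype.ext (Subtype.ext h))
    have hgf : g ≠ f := fun h => hcon.2 (Subtype.ext (Subtype.ext h))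
    refine no_three hv h2 hp ![e, f, g] ?_ ?_ ?_ ?_
    · intro i; fin_cases i
      · exact he
      · exact hf
      · exact hg
    · intro i; fin_cases i
      · exact hde1
      · exact hdf1
      · exact hdg
    · intro i; fin_cases i
      · exact hpe
      · exact hpf'
      · exact hpg'
    · intro i j hij
      fin_cases i <;> fin_cases j <;> simp at hij <;> first | rfl | skip
      · exact absurd hij hef
      · exact absurd hij.symm hge
      · exact absurd hij.symm hef
      · exact absurd hij.symm hgf
      · exact absurd hij hge
      · exact absurd hij hgf

theorem card_inc
    {v : Finset E} (hv : Set.extremePoints ℝ (convexHull ℝ (v : Set E)) = (v : Set E))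
    (h2 : pdim (convexHull ℝ (v : Set E)) = 2) : Nat.card {x : v × Edge (convexHull ℝ (v : Set E)) // pinc v x.1 x.2} =
    2 * v.card ∧ Nat.card (Edge (convexHull ℝ (v : Set E))) = v.card := by
  classical
  have := edge_finite v
  have := Fintype.ofFinite (Edge (convexHull ℝ (v : Set E)))
  have h1 : Nat.card {x : v × Edge (convexHull ℝ (v : Set E)) // pinc v x.1 x.2} = 2 * v.card := by
    rw [Nat.card_congr (Equiv.subtypeProdEquivSigmaSubtype (pinc v)), Nat.card_sigma]
    simp only [card_vert hv h2]
    simp [mul_comm]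
  have h3 : Nat.card {x : v × Edge (convexHull ℝ (v : Set E)) // pinc v x.1 x.2} =
      2 * Nat.card (Edge (convexHull ℝ (v : Set E))) := by
    have e1 : {x : v × Edge (convexHull ℝ (v : Set E)) // pinc v x.1 x.2} ≃
        {x : Edge (convexHull ℝ (v : Set E)) × v // pinc v x.2 x.1} :=
      (Equiv.prodComm _ _).subtypeEquiv (fun _ => Iff.rfl)
    rw [Nat.card_congr e1,
      Nat.card_congr (Equiv.subtypeProdEquivSigmaSubtype (fun e a => pinc v a e)), Nat.card_sigma]
    simp only [card_edge hv]
    simp [mul_comm]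
  exact ⟨h1, by omega⟩

theorem poly_coding
    {v : Finset E} (hv : Set.extremePoints ℝ (convexHull ℝ (v : Set E)) = (v : Set E))
    (h2 : pdim (convexHull ℝ (v : Set E)) = 2) : Coding (pinc v) ∅ (convexHull ℝ (v : Set E)) (pcode v) := by
  have hvne : (v : Set E).Nonempty := by
    by_contra h
    rw [Set.not_nonempty_iff_eq_empty] at h
    rw [h, convexHull_empty] at h2
    rw [pdim, direction_affineSpan, vectorSpan_empty, finrank_bot] at h2
    omega
  have hB := face_self hvne
  have hvert : ∀ a : v, IsFaceOf (convexHull ℝ (v : Set E)) {a.1} := fun a =>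
    face_vertex v.finite_toSet (by rw [hv]; exact a.2) a.2
  have hdle : ∀ {F G : Set E}, F ⊆ G → G ⊆ convexHull ℝ (v : Set E) → pdim F ≤ pdim G :=
    fun h h' => pdim_mono v.finite_toSet h h'
  refine ⟨?_, ?_, ?_, ?_⟩
  · rintro ⟨J, g⟩ -
    cases g with
    | bot => exact Or.inl rfl
    | vert a => exact Or.inr (hvert a)
    | edge e => exact Or.inr e.2.1
    | top => exact Or.inr hB
  · rintro ⟨J, g⟩ hJ
    have hJ' : J = ∅ := Finset.subset_empty.1 hJ
    subst hJ'
    rw [Finset.card_empty, zero_add]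
    cases g with
    | bot => exact if_pos rfl
    | vert a =>
      change erk ({a.1} : Set E) = 1
      rw [erk, if_neg (Set.singleton_ne_empty _), pdim_singleton]
    | edge e =>
      change erk e.1 = 2
      rw [erk, if_neg e.2.1.2.ne_empty, e.2.2]
    | top =>
      change erk (convexHull ℝ (v : Set E)) = 3
      rw [erk, if_neg hB.2.ne_empty, h2]
  · rintro F (rfl | hF)
    · exact ⟨(∅, PF.bot), Finset.Subset.refl _, rfl⟩
    have hsub := face_subset hF
    have hle := hdle hsub Subset.rfl
    rw [h2] at hle
    interval_cases hd : pdim F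
    · have hne : ((v : Set E) ∩ F).Nonempty := by
        rw [← convexHull_nonempty_iff (𝕜 := ℝ), ← face_hull hF]
        exact hF.2
      obtain ⟨p, hp, hpF⟩ := hne
      refine ⟨(∅, PF.vert ⟨p, hp⟩), Finset.Subset.refl _, ?_⟩
      change {p} = F
      by_contra hne
      have := face_pdim_lt v.finite_toSet (hvert ⟨p, hp⟩) hF
        (((Set.singleton_subset_iff).2 hpF).ssubset_of_ne hne)
      omega
    · exact ⟨(∅, PF.edge ⟨F, hF, hd⟩), Finset.Subset.refl _, rfl⟩
    · refine ⟨(∅, PF.top), Finset.Subset.refl _, ?_⟩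
      change convexHull ℝ (v : Set E) = F
      by_contra hne
      have := face_pdim_lt v.finite_toSet hF hB (hsub.ssubset_of_ne (Ne.symm hne))
      omega
  · rintro ⟨J, g⟩ ⟨J', g'⟩ hJ hJ'
    have e1 : J = ∅ := Finset.subset_empty.1 hJ
    have e2 : J' = ∅ := Finset.subset_empty.1 hJ'
    subst e1 e2
    have hpl : plle (pinc v) (∅, g) (∅, g') ↔ PF.le (pinc v) g g' :=
      ⟨fun h => h.2, fun h => ⟨Finset.Subset.refl _, h⟩⟩
    rw [hpl]
    cases g with
    | bot =>
      cases g' <;> exact ⟨fun _ => Set.empty_subset _, fun _ => trivial⟩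
    | vert a =>
      cases g' with
      | bot => exact ⟨fun h => h.elim, fun h => (h (Set.mem_singleton a.1)).elim⟩
      | vert b =>
        change a = b ↔ ({a.1} : Set E) ⊆ {b.1}
        rw [Set.singleton_subset_singleton, Subtype.ext_iff]
      | edge e =>
        change a.1 ∈ e.1 ↔ ({a.1} : Set E) ⊆ e.1
        rw [Set.singleton_subset_iff]
      | top =>
        exact ⟨fun _ => face_subset (hvert a), fun _ => trivial⟩
    | edge e =>
      cases g' with
      | bot => exact ⟨fun h => h.elim, fun h => by
          obtain ⟨z, hz⟩ := e.2.1.2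
          exact (h hz).elim⟩
      | vert b =>
        refine ⟨fun h => h.elim, fun h => ?_⟩
        have h3 : pdim e.1 ≤ pdim {b.1} := hdle h (face_subset (hvert b))
        rw [pdim_singleton, e.2.2] at h3
        omega
      | edge f =>
        change e = f ↔ e.1 ⊆ f.1
        constructor
        · rintro rfl; exact Subset.rfl
        · intro h
          apply Subtype.ext
          by_contra hne
          have := face_pdim_lt v.finite_toSet e.2.1 f.2.1 (h.ssubset_of_ne hne)
          rw [e.2.2, f.2.2] at this
          omega
      | top => exact ⟨fun _ => face_subset e.2.1, fun _ => trivial⟩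
    | top =>
      cases g' with
      | bot => exact ⟨fun h => h.elim, fun h => by
          obtain ⟨z, hz⟩ := hB.2
          exact (h hz).elim⟩
      | vert b =>
        refine ⟨fun h => h.elim, fun h => ?_⟩
        have h3 : pdim (convexHull ℝ (v : Set E)) ≤ pdim {b.1} := hdle h (face_subset (hvert b))
        rw [pdim_singleton] at h3
        omega
      | edge f =>
        refine ⟨fun h => h.elim, fun h => ?_⟩
        have h3 : pdim (convexHull ℝ (v : Set E)) ≤ pdim f.1 := hdle h (face_subset f.2.1)
        rw [f.2.2] at h3
        omega
      | top => exact ⟨fun _ => Subset.rfl, fun _ => trivial⟩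

end poly2


/-- The multiplex `M^{d,n}` has the same flag vector as the `(d-2)`-fold pyramid
`Q^{d,n-d}` over the `(n-d+3)`-gon: `f_S(M^{d,n}) = f_S(Q^{d,n-d})` for every
`S ⊆ {0,1,…,d-1}`. -/
theorem multiplex_flagVector_eq_pyramid_flagVector
    {E' : Type*} [NormedAddCommGroup E'] [NormedSpace ℝ E']
    (d n : ℕ) (hd : 2 ≤ d) (hdn : d ≤ n)
    (P : Set E) (x : ℤ → E) (hM : IsMultiplex d n P x)
    (B Q : Set E') (hB : IsPolygon (n - d + 3) B) (hQ : IsKFoldPyramid (d - 2) Q B)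
    (S : Finset ℕ) (hS : S ⊆ Finset.range d) :
    flagNum P S = flagNum Q S := by
  obtain ⟨v, hvc, rfl, hv, h2⟩ := hB
  have hS' : ∀ s ∈ S, s < d := fun s hs => Finset.mem_range.1 (hS hs)
  have hvne : (v : Set E').Nonempty := by
    rw [Finset.coe_nonempty, ← Finset.card_pos]
    omega
  obtain ⟨Y, -, -, -, Ψ, hΨ⟩ :=
    pyr_coding v.finite_toSet hvne (poly_coding hv h2) (d - 2) Q hQ
  have hM' : Finset.Icc (2:ℤ) (((d - 2 : ℕ) : ℤ) + 1) = Finset.Icc (2:ℤ) (d - 1) := by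
    congr 1
    omega
  rw [hM'] at hΨ
  have := edge_finite v
  obtain ⟨c1, c2⟩ := card_inc hv h2
  rw [multi_count hM S hS', tok_count d n hd hdn S hS', hΨ.count S, cnt_pl, c1, c2, hvc]
  simp [hvc]
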